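/- arXiv:1012.3231 — 4 statements merged into one kernel-verified Lean document; each statement's English description precedes it below -/
import Mathlib

section
/- There exists L₀ > 0 such that for every L ≥ L₀ the following holds: if u is a C² function on an open neighborhood of [0,3L] × ℝ in ℝ² that is 2π-periodic in its second variable θ and harmonic (∂²u/∂t² + ∂²u/∂θ² = 0), then ‖u‖₁,₂² ≤ (1/2)(e^L ‖u‖₁,₃² + e^{-L} ‖u‖₁,₁²). -/
open Real MeasureTheory

/-- Squared `W^{1,2}`-norm of `u` over the cylinder piece `[(i-1)L, iL] × [0, 2π]`:
`‖u‖₁,ᵢ² = ∫_{(i-1)L}^{iL} ∫_0^{2π} (|u|² + |∂_t u|² + |∂_θ u|²) dθ dt`. -/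
noncomputable def normOneSq (L : ℝ) (i : ℕ) (u : ℝ × ℝ → ℝ) : ℝ :=
  ∫ t in (((i : ℝ) - 1) * L)..((i : ℝ) * L), ∫ θ in (0 : ℝ)..(2 * π),
    (u (t, θ)) ^ 2 + (fderiv ℝ u (t, θ) (1, 0)) ^ 2 + (fderiv ℝ u (t, θ) (0, 1)) ^ 2

/-- `u` is harmonic at `p`: `∂²u/∂t² + ∂²u/∂θ² = 0` at `p`. -/
def IsHarmonicAt (u : ℝ × ℝ → ℝ) (p : ℝ × ℝ) : Prop :=
  fderiv ℝ (fun q => fderiv ℝ u q (1, 0)) p (1, 0) +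
    fderiv ℝ (fun q => fderiv ℝ u q (0, 1)) p (0, 1) = 0

/-- If `f'' = m f` with `m ≥ 1`, then `eᵗ ((1 + m) ‖f‖² + ‖f'‖²)` is convex. -/
lemma convexOn_exp_mul_energy {a b m : ℝ} {f g : ℝ → ℂ} (hm : 1 ≤ m)
    (hf : ∀ t ∈ Set.Ioo a b, HasDerivAt f (g t) t)
    (hg : ∀ t ∈ Set.Ioo a b, HasDerivAt g (m • f t) t) :
    ConvexOn ℝ (Set.Ioo a b) (fun t => exp t * ((1 + m) * ‖f t‖ ^ 2 + ‖g t‖ ^ 2)) := by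
  have h1 : ∀ t ∈ Set.Ioo a b,
      HasDerivAt (fun t => exp t * ((1 + m) * ‖f t‖ ^ 2 + ‖g t‖ ^ 2))
        (exp t * ((1 + m) * ‖f t‖ ^ 2 + ‖g t‖ ^ 2 + 2 * (1 + 2 * m) * inner ℝ (f t) (g t))) t := by
    intro t ht
    have := (Real.hasDerivAt_exp t).mul
      (((hf t ht).norm_sq.const_mul (1 + m)).add (hg t ht).norm_sq)
    refine this.congr_deriv ?_
    rw [inner_smul_right, real_inner_comm (f t) (g t)]
    simp only [Pi.add_apply]
    ring
  have h2 : ∀ t ∈ Set.Ioo a b,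
      HasDerivAt (fun t => exp t * ((1 + m) * ‖f t‖ ^ 2 + ‖g t‖ ^ 2
          + 2 * (1 + 2 * m) * inner ℝ (f t) (g t)))
        (exp t * ((1 + m) * ‖f t‖ ^ 2 + ‖g t‖ ^ 2 + 4 * (1 + 2 * m) * inner ℝ (f t) (g t)
          + 2 * (1 + 2 * m) * (‖g t‖ ^ 2 + m * ‖f t‖ ^ 2))) t := by
    intro t ht
    have := (Real.hasDerivAt_exp t).mul
      ((((hf t ht).norm_sq.const_mul (1 + m)).add (hg t ht).norm_sq).add
        (((hf t ht).inner ℝ (hg t ht)).const_mul (2 * (1 + 2 * m))))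
    refine this.congr_deriv ?_
    rw [inner_smul_right, inner_smul_right, real_inner_comm (f t) (g t),
      real_inner_self_eq_norm_sq, real_inner_self_eq_norm_sq]
    simp only [Pi.add_apply]
    ring
  refine convexOn_of_hasDerivWithinAt2_nonneg (convex_Ioo a b)
    (fun t ht => (h1 t ht).continuousAt.continuousWithinAt)
    (fun t ht => (h1 t (interior_subset ht)).hasDerivWithinAt)
    (fun t ht => (h2 t (interior_subset ht)).hasDerivWithinAt) fun t ht => ?_
  have hi : -(‖f t‖ * ‖g t‖) ≤ inner ℝ (f t) (g t) :=
    neg_le_of_abs_le (abs_real_inner_le_norm _ _)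
  refine mul_nonneg (exp_pos t).le ?_
  have hx : 0 ≤ (4 * m ^ 2 - m - 1) * ‖f t‖ ^ 2 := by
    refine mul_nonneg ?_ (sq_nonneg _)
    nlinarith
  have hi' := mul_le_mul_of_nonneg_left hi (by linarith : 0 ≤ 4 * (1 + 2 * m))
  have hs : 0 ≤ 2 * (1 + 2 * m) * (‖f t‖ - ‖g t‖) ^ 2 :=
    mul_nonneg (by linarith) (sq_nonneg _)
  nlinarith [sq_nonneg ‖g t‖]

/-- Midpoint form of `convexOn_exp_mul_energy`. -/
lemma energy_three_point {a b m L t : ℝ} {f g : ℝ → ℂ} (hm : 1 ≤ m)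
    (hf : ∀ t ∈ Set.Ioo a b, HasDerivAt f (g t) t)
    (hg : ∀ t ∈ Set.Ioo a b, HasDerivAt g (m • f t) t)
    (h₁ : t - L ∈ Set.Ioo a b) (h₂ : t + L ∈ Set.Ioo a b) :
    (1 + m) * ‖f t‖ ^ 2 + ‖g t‖ ^ 2 ≤
      (1 / 2) * (exp L * ((1 + m) * ‖f (t + L)‖ ^ 2 + ‖g (t + L)‖ ^ 2)
        + exp (-L) * ((1 + m) * ‖f (t - L)‖ ^ 2 + ‖g (t - L)‖ ^ 2)) := by
  have h := (convexOn_exp_mul_energy hm hf hg).2 h₁ h₂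
    (by norm_num : (0 : ℝ) ≤ 1 / 2) (by norm_num : (0 : ℝ) ≤ 1 / 2) (by norm_num)
  simp only [smul_eq_mul] at h
  rw [show 1 / 2 * (t - L) + 1 / 2 * (t + L) = t by ring, exp_add, sub_eq_add_neg t L,
    exp_add] at h
  rw [sub_eq_add_neg t L]
  refine le_of_mul_le_mul_left (h.trans_eq ?_) (exp_pos t)
  ring

/-- The zero mode is affine, and satisfies the three point estimate as soon as
`4 L² + 2 ≤ e^L` and `4 ≤ e^L`. -/
lemma energy_three_point_affine {a b L t : ℝ} {f g : ℝ → ℂ}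
    (hL : 4 ≤ exp L) (hL' : 4 * L ^ 2 + 2 ≤ exp L)
    (hf : ∀ t ∈ Set.Ioo a b, HasDerivAt f (g t) t)
    (hg : ∀ t ∈ Set.Ioo a b, HasDerivAt g 0 t)
    (h₁ : t ∈ Set.Ioo a b) (h₂ : t + L ∈ Set.Ioo a b) :
    ‖f t‖ ^ 2 + ‖g t‖ ^ 2 ≤
      (1 / 2) * (exp L * (‖f (t + L)‖ ^ 2 + ‖g (t + L)‖ ^ 2)
        + exp (-L) * (‖f (t - L)‖ ^ 2 + ‖g (t - L)‖ ^ 2)) := by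
  have hgc : ∀ s ∈ Set.Ioo a b, g s = g t := fun s hs =>
    isOpen_Ioo.is_const_of_deriv_eq_zero isPreconnected_Ioo
      (fun x hx => (hg x hx).differentiableAt.differentiableWithinAt)
      (fun x hx => (hg x hx).deriv) hs h₁
  have hd : ∀ s ∈ Set.Ioo a b, HasDerivAt (fun s => f s - s • g t) 0 s := fun s hs => by
    have := (hf s hs).sub ((hasDerivAt_id s).smul_const (g t))
    exact this.congr_deriv (by simp [hgc s hs])
  have hfc : f (t + L) - (t + L) • g t = f t - t • g t :=
    isOpen_Ioo.is_const_of_deriv_eq_zero isPreconnected_Ioo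
      (fun x hx => (hd x hx).differentiableAt.differentiableWithinAt)
      (fun x hx => (hd x hx).deriv) h₂ h₁
  have hft : f t = f (t + L) - L • g t := by
    rw [add_smul] at hfc
    linear_combination -hfc
  have hn : ‖f t‖ ≤ ‖f (t + L)‖ + |L| * ‖g t‖ := by
    rw [hft]
    refine (norm_sub_le _ _).trans ?_
    rw [norm_smul, Real.norm_eq_abs]
  have hsq : ‖f t‖ ^ 2 ≤ 2 * ‖f (t + L)‖ ^ 2 + 2 * L ^ 2 * ‖g t‖ ^ 2 := by
    have := pow_le_pow_left₀ (norm_nonneg _) hn 2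
    nlinarith [sq_nonneg (‖f (t + L)‖ - |L| * ‖g t‖), sq_abs L]
  rw [hgc _ h₂]
  have h3 := mul_le_mul_of_nonneg_right hL (sq_nonneg ‖f (t + L)‖)
  have h4 := mul_le_mul_of_nonneg_right hL' (sq_nonneg ‖g t‖)
  have h5 : 0 ≤ exp (-L) * (‖f (t - L)‖ ^ 2 + ‖g (t - L)‖ ^ 2) := by positivity
  linarith

/-- The `k`-th Fourier coefficient of `w (t, ·)` on `[0, 2π]`. -/
noncomputable def circleCoeff (w : ℝ × ℝ → ℝ) (k : ℤ) (t : ℝ) : ℂ :=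
  fourierCoeffOn two_pi_pos (fun θ => (w (t, θ) : ℂ)) k

/-- Differentiation in the angle multiplies the `k`-th Fourier coefficient by `i k`. -/
lemma circleCoeff_fderiv_angle {U : Set (ℝ × ℝ)} {w : ℝ × ℝ → ℝ} {t : ℝ} (hU : IsOpen U)
    (hw : ContDiffOn ℝ 1 w U) (ht : ∀ θ, (t, θ) ∈ U) (hper : w (t, 2 * π) = w (t, 0)) (k : ℤ) :
    circleCoeff (fun p => fderiv ℝ w p (0, 1)) k t = Complex.I * k * circleCoeff w k t := by
  have hd : ∀ θ, HasDerivAt (fun θ => (w (t, θ) : ℂ)) (fderiv ℝ w (t, θ) (0, 1) : ℝ) θ := by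
    intro θ
    have h := ((hw.contDiffAt (hU.mem_nhds (ht θ))).differentiableAt one_ne_zero).hasFDerivAt
    exact (h.comp_hasDerivAt θ ((hasDerivAt_const θ t).prodMk (hasDerivAt_id θ))).ofReal_comp
  have hc : Continuous (fun θ => ((fderiv ℝ w (t, θ) (0, 1) : ℝ) : ℂ)) := by
    have h : ContinuousOn (fderiv ℝ w) U := hw.continuousOn_fderiv_of_isOpen hU le_rfl
    have h' : Continuous fun θ : ℝ => fderiv ℝ w (t, θ) :=
      h.comp_continuous (by fun_prop) ht
    fun_prop
  rcases eq_or_ne k 0 with rfl | hk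
  · simp only [circleCoeff, fourierCoeffOn_eq_integral, neg_zero, fourier_zero, one_smul,
      Int.cast_zero, mul_zero, zero_mul]
    rw [intervalIntegral.integral_eq_sub_of_hasDerivAt (fun θ _ => hd θ)
      (hc.intervalIntegrable _ _), hper]
    simp
  · have h := fourierCoeffOn_of_hasDerivAt two_pi_pos hk (fun θ _ => hd θ)
      (hc.intervalIntegrable _ _)
    simp only [circleCoeff]
    rw [h, hper]
    have : (k : ℂ) ≠ 0 := by exact_mod_cast hk
    have : (π : ℂ) ≠ 0 := by exact_mod_cast pi_ne_zero
    push_cast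
    field_simp
    ring

/-- Fourier coefficients in the angle commute with differentiation in `t`. -/
lemma hasDerivAt_circleCoeff {U : Set (ℝ × ℝ)} {w : ℝ × ℝ → ℝ} {a b t : ℝ} (hU : IsOpen U)
    (hw : ContDiffOn ℝ 1 w U) (hab : Set.Ioo a b ×ˢ (Set.univ : Set ℝ) ⊆ U)
    (ht : t ∈ Set.Ioo a b) (k : ℤ) :
    HasDerivAt (circleCoeff w k) (circleCoeff (fun p => fderiv ℝ w p (1, 0)) k t) t := by
  have hd : ∀ s ∈ Set.Ioo a b, ∀ θ,
      HasDerivAt (fun s => (w (s, θ) : ℂ)) (fderiv ℝ w (s, θ) (1, 0) : ℝ) s := by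
    intro s hs θ
    have h := ((hw.contDiffAt (hU.mem_nhds (hab ⟨hs, trivial⟩))).differentiableAt
      one_ne_zero).hasFDerivAt (x := (s, θ))
    exact (h.comp_hasDerivAt s ((hasDerivAt_id s).prodMk (hasDerivAt_const s θ))).ofReal_comp
  have hfd : ContinuousOn (fderiv ℝ w) U := hw.continuousOn_fderiv_of_isOpen hU le_rfl
  have hcw : ∀ s ∈ Set.Ioo a b, Continuous fun θ : ℝ => w (s, θ) := fun s hs =>
    hw.continuousOn.comp_continuous (by fun_prop) fun θ => hab ⟨hs, trivial⟩
  have hcd : ∀ s ∈ Set.Ioo a b, Continuous fun θ : ℝ => fderiv ℝ w (s, θ) := fun s hs =>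
    hfd.comp_continuous (by fun_prop) fun θ => hab ⟨hs, trivial⟩
  have hfour : Continuous fun θ : ℝ => fourier (-k) (θ : AddCircle (2 * π - 0)) :=
    (map_continuous (fourier (-k))).comp (AddCircle.continuous_mk' _)
  obtain ⟨ε, hε, hball⟩ := Metric.isOpen_iff.1 isOpen_Ioo t ht
  have hsub : Metric.closedBall t (ε / 2) ⊆ Set.Ioo a b :=
    (Metric.closedBall_subset_ball (half_lt_self hε)).trans hball
  obtain ⟨C, hC⟩ := ((isCompact_closedBall t (ε / 2)).prod
    (isCompact_uIcc (a := 0) (b := 2 * π))).exists_bound_of_continuousOn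
    (f := fun p => fderiv ℝ w p (1, 0))
    ((hfd.mono fun p hp => hab ⟨hsub hp.1, trivial⟩).clm_apply continuousOn_const)
  have key := intervalIntegral.hasDerivAt_integral_of_dominated_loc_of_deriv_le
    (μ := volume) (a := 0) (b := 2 * π) (x₀ := t) (s := Metric.closedBall t (ε / 2))
    (F := fun s θ => fourier (-k) (θ : AddCircle (2 * π - 0)) • (w (s, θ) : ℂ))
    (F' := fun s θ => fourier (-k) (θ : AddCircle (2 * π - 0)) •
      ((fderiv ℝ w (s, θ) (1, 0) : ℝ) : ℂ))
    (bound := fun _ => C)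
    (Metric.closedBall_mem_nhds t (half_pos hε)) ?_ ?_ ?_ ?_ ?_ ?_
  · have h := key.2.const_smul (1 / (2 * π - 0))
    have h1 : circleCoeff w k = fun s => (1 / (2 * π - 0)) •
        ∫ θ in (0 : ℝ)..(2 * π), fourier (-k) (θ : AddCircle (2 * π - 0)) • (w (s, θ) : ℂ) := by
      funext s
      rw [circleCoeff, fourierCoeffOn_eq_integral]
    rw [h1, circleCoeff, fourierCoeffOn_eq_integral]
    exact h
  · filter_upwards [isOpen_Ioo.mem_nhds ht] with s hs
    exact (hfour.smul (Complex.continuous_ofReal.comp (hcw s hs))).aestronglyMeasurable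
  · exact (hfour.smul (Complex.continuous_ofReal.comp (hcw t ht))).intervalIntegrable _ _
  · have := hcd t ht
    exact Continuous.aestronglyMeasurable (by fun_prop)
  · refine Filter.Eventually.of_forall fun θ hθ s hs => ?_
    rw [norm_smul, fourier_apply, Circle.norm_coe, one_mul, Complex.norm_real]
    exact hC (s, θ) ⟨hs, Set.uIoc_subset_uIcc hθ⟩
  · exact intervalIntegrable_const
  · exact Filter.Eventually.of_forall fun θ _ s hs => (hd s (hsub hs) θ).const_mul _

/-- Parseval's identity on the circle `{t} × S¹`. -/
lemma hasSum_circleCoeff {w : ℝ × ℝ → ℝ} {t : ℝ} (hw : Continuous fun θ : ℝ => w (t, θ)) :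
    HasSum (fun k => ‖circleCoeff w k t‖ ^ 2)
      ((2 * π)⁻¹ * ∫ θ in (0 : ℝ)..(2 * π), w (t, θ) ^ 2) := by
  have hc : Continuous fun θ => (w (t, θ) : ℂ) := Complex.continuous_ofReal.comp hw
  have hL : MemLp (fun θ => (w (t, θ) : ℂ)) 2 (volume.restrict (Set.Ioc 0 (2 * π))) :=
    (memLp_two_iff_integrable_sq_norm hc.aestronglyMeasurable).2
      (Continuous.integrableOn_Ioc (by fun_prop))
  simpa [Complex.norm_real, circleCoeff] using hasSum_sq_fourierCoeffOn two_pi_pos hL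

/-- The energy density at height `t`, integrated over the circle. -/
noncomputable def circleEnergy (u : ℝ × ℝ → ℝ) (t : ℝ) : ℝ :=
  ∫ θ in (0 : ℝ)..(2 * π),
    (u (t, θ)) ^ 2 + (fderiv ℝ u (t, θ) (1, 0)) ^ 2 + (fderiv ℝ u (t, θ) (0, 1)) ^ 2

lemma circleCoeff_neg (w : ℝ × ℝ → ℝ) (k : ℤ) (t : ℝ) :
    circleCoeff (fun p => -w p) k t = -circleCoeff w k t := by
  simp only [circleCoeff, fourierCoeffOn_eq_integral]
  simp [intervalIntegral.integral_neg]

lemma fderiv_periodic {u : ℝ × ℝ → ℝ} {c : ℝ} (hper : ∀ t θ, u (t, θ + c) = u (t, θ))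
    (t θ : ℝ) : fderiv ℝ u (t, θ + c) = fderiv ℝ u (t, θ) := by
  have h : (fun p : ℝ × ℝ => u (p + (0, c))) = u := by
    funext ⟨x, y⟩
    simpa using hper x y
  have h' := fderiv_comp_add_right (𝕜 := ℝ) (f := u) (x := (t, θ)) (0, c)
  rw [h] at h'
  simpa using h'.symm

/-- Pointwise three point estimate for the circle energy of a harmonic function, obtained by
summing the estimates for its Fourier modes. -/
lemma circleEnergy_three_point {L t : ℝ} {U : Set (ℝ × ℝ)} {u : ℝ × ℝ → ℝ}
    (hL : 4 ≤ exp L) (hL' : 4 * L ^ 2 + 2 ≤ exp L) (hU : IsOpen U) {a b : ℝ}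
    (hab : Set.Ioo a b ×ˢ (Set.univ : Set ℝ) ⊆ U) (hu : ContDiffOn ℝ 2 u U)
    (hper : ∀ t θ : ℝ, u (t, θ + 2 * π) = u (t, θ)) (hh : ∀ p ∈ U, IsHarmonicAt u p)
    (h₀ : t ∈ Set.Ioo a b) (h₁ : t - L ∈ Set.Ioo a b) (h₂ : t + L ∈ Set.Ioo a b) :
    circleEnergy u t ≤
      (1 / 2) * (exp L * circleEnergy u (t + L) + exp (-L) * circleEnergy u (t - L)) := by
  have hu1 : ContDiffOn ℝ 1 u U := hu.of_le (by norm_num)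
  have hfd : ContDiffOn ℝ 1 (fderiv ℝ u) U := hu.fderiv_of_isOpen hU (by norm_num)
  have hut : ContDiffOn ℝ 1 (fun p => fderiv ℝ u p (1, 0)) U := hfd.clm_apply contDiffOn_const
  have huθ : ContDiffOn ℝ 1 (fun p => fderiv ℝ u p (0, 1)) U := hfd.clm_apply contDiffOn_const
  have hmem : ∀ s ∈ Set.Ioo a b, ∀ θ : ℝ, (s, θ) ∈ U := fun s hs θ => hab ⟨hs, trivial⟩
  have hcoefθ : ∀ s ∈ Set.Ioo a b, ∀ k : ℤ,
      circleCoeff (fun p => fderiv ℝ u p (0, 1)) k s = Complex.I * k * circleCoeff u k s :=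
    fun s hs => circleCoeff_fderiv_angle hU hu1 (hmem s hs) (by simpa using hper s 0)
  have hf : ∀ k : ℤ, ∀ s ∈ Set.Ioo a b, HasDerivAt (circleCoeff u k)
      (circleCoeff (fun p => fderiv ℝ u p (1, 0)) k s) s :=
    fun k s hs => hasDerivAt_circleCoeff hU hu1 hab hs k
  have hg : ∀ k : ℤ, ∀ s ∈ Set.Ioo a b,
      HasDerivAt (circleCoeff (fun p => fderiv ℝ u p (1, 0)) k)
        (((k : ℝ) ^ 2) • circleCoeff u k s) s := by
    intro k s hs
    refine (hasDerivAt_circleCoeff hU hut hab hs k).congr_deriv ?_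
    have h1 : circleCoeff (fun p => fderiv ℝ (fun q => fderiv ℝ u q (1, 0)) p (1, 0)) k s
        = circleCoeff (fun p => -fderiv ℝ (fun q => fderiv ℝ u q (0, 1)) p (0, 1)) k s := by
      have : ∀ θ, fderiv ℝ (fun q => fderiv ℝ u q (1, 0)) (s, θ) (1, 0)
          = -fderiv ℝ (fun q => fderiv ℝ u q (0, 1)) (s, θ) (0, 1) :=
        fun θ => eq_neg_of_add_eq_zero_left (hh _ (hmem s hs θ))
      simp only [circleCoeff, this]
    rw [h1, circleCoeff_neg, circleCoeff_fderiv_angle hU huθ (hmem s hs)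
      (by simpa using congrArg (fun A => A (0, 1)) (fderiv_periodic hper s 0)), hcoefθ s hs,
      Complex.real_smul]
    push_cast
    linear_combination (-(k : ℂ) ^ 2 * circleCoeff u k s) * Complex.I_sq
  have hsum : ∀ s ∈ Set.Ioo a b, HasSum (fun k : ℤ => (1 + (k : ℝ) ^ 2) * ‖circleCoeff u k s‖ ^ 2
      + ‖circleCoeff (fun p => fderiv ℝ u p (1, 0)) k s‖ ^ 2)
      ((2 * π)⁻¹ * circleEnergy u s) := by
    intro s hs
    have hline : ∀ w : ℝ × ℝ → ℝ, ContDiffOn ℝ 1 w U → Continuous fun θ : ℝ => w (s, θ) :=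
      fun w hw => hw.continuousOn.comp_continuous (by fun_prop) (hmem s hs)
    have c0 := hline _ hu1
    have c1 := hline _ hut
    have c2 := hline _ huθ
    have h := ((hasSum_circleCoeff (w := u) c0).add
      (hasSum_circleCoeff (w := fun p => fderiv ℝ u p (1, 0)) c1)).add
      (hasSum_circleCoeff (w := fun p => fderiv ℝ u p (0, 1)) c2)
    rw [← mul_add, ← mul_add, ← intervalIntegral.integral_add, ← intervalIntegral.integral_add]
      at h
    · convert h using 2 with k
      · rw [hcoefθ s hs, norm_mul, norm_mul, Complex.norm_I, Complex.norm_intCast, mul_pow,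
          mul_pow, sq_abs]
        ring
      · rfl
    · exact ((c0.pow 2).add (c1.pow 2)).intervalIntegrable _ _
    · exact (c2.pow 2).intervalIntegrable _ _
    · exact (c0.pow 2).intervalIntegrable _ _
    · exact (c1.pow 2).intervalIntegrable _ _
  have h := hasSum_le (fun k => ?_) (hsum t h₀)
    ((((hsum _ h₂).mul_left (exp L)).add ((hsum _ h₁).mul_left (exp (-L)))).mul_left (1 / 2))
  · refine le_of_mul_le_mul_left (h.trans_eq ?_) (inv_pos.2 two_pi_pos)
    ring
  · rcases eq_or_ne k 0 with rfl | hk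
    · have := energy_three_point_affine hL hL' (hf 0) (by simpa using hg 0) h₀ h₂
      simpa using this
    · have hk' : 0 < k ^ 2 := by positivity
      exact energy_three_point (by exact_mod_cast hk') (hf k) (hg k) h₁ h₂

lemma intervalIntegrable_circleEnergy {U : Set (ℝ × ℝ)} {u : ℝ × ℝ → ℝ} {a b : ℝ}
    (hle : a ≤ b) (hU : IsOpen U) (hab : Set.Icc a b ×ˢ (Set.univ : Set ℝ) ⊆ U)
    (hu : ContDiffOn ℝ 1 u U) : IntervalIntegrable (circleEnergy u) volume a b := by
  have hfd : ContinuousOn (fderiv ℝ u) U := hu.continuousOn_fderiv_of_isOpen hU le_rfl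
  have hc : ContinuousOn (fun p : ℝ × ℝ => (u p) ^ 2 + (fderiv ℝ u p (1, 0)) ^ 2
      + (fderiv ℝ u p (0, 1)) ^ 2) (Set.Icc a b ×ˢ Set.Icc 0 (2 * π)) := by
    refine ContinuousOn.mono ?_ ((Set.prod_mono_right (Set.subset_univ _)).trans hab)
    exact ((hu.continuousOn.pow 2).add ((hfd.clm_apply continuousOn_const).pow 2)).add
      ((hfd.clm_apply continuousOn_const).pow 2)
  have hi := (hc.integrableOn_compact (μ := volume) (isCompact_Icc.prod isCompact_Icc)).mono_set
    (Set.prod_mono Set.Ioc_subset_Icc_self Set.Ioc_subset_Icc_self)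
  rw [IntegrableOn, Measure.volume_eq_prod, ← Measure.prod_restrict] at hi
  rw [intervalIntegrable_iff_integrableOn_Ioc_of_le hle]
  have := hi.integral_prod_left
  unfold circleEnergy
  simp only [intervalIntegral.integral_of_le two_pi_pos.le]
  exact this

/-- There exists `L₀ > 0` such that for every `L ≥ L₀`, any `C²` function on a neighborhood of
`[0,3L] × ℝ` which is `2π`-periodic in `θ` and harmonic satisfies
`‖u‖₁,₂² ≤ (1/2)(e^L ‖u‖₁,₃² + e^{-L} ‖u‖₁,₁²)`. -/
theorem harmonic_three_annuli_estimate :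
    ∃ L₀ : ℝ, 0 < L₀ ∧ ∀ L : ℝ, L₀ ≤ L →
      ∀ (U : Set (ℝ × ℝ)) (u : ℝ × ℝ → ℝ),
        IsOpen U → (Set.Icc (0 : ℝ) (3 * L)) ×ˢ (Set.univ : Set ℝ) ⊆ U →
        ContDiffOn ℝ 2 u U →
        (∀ t θ : ℝ, u (t, θ + 2 * π) = u (t, θ)) →
        (∀ p ∈ U, IsHarmonicAt u p) →
        normOneSq L 2 u ≤
          (1 / 2) * (Real.exp L * normOneSq L 3 u + Real.exp (-L) * normOneSq L 1 u) := by
  refine ⟨12, by norm_num, fun L hL U u hU hsub hu hper hh => ?_⟩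
  have hexp : 4 * L ^ 2 + 2 ≤ exp L := by
    have h := pow_div_factorial_le_exp L (by linarith) 4
    norm_num [Nat.factorial] at h
    nlinarith [mul_nonneg (sq_nonneg L) (by nlinarith : 0 ≤ L ^ 2 - 144)]
  have hexp' : 4 ≤ exp L := by nlinarith
  have hsub' : Set.Ioo 0 (3 * L) ×ˢ (Set.univ : Set ℝ) ⊆ U :=
    (Set.prod_mono_left Set.Ioo_subset_Icc_self).trans hsub
  have hint : ∀ {c d : ℝ}, 0 ≤ c → c ≤ d → d ≤ 3 * L →
      IntervalIntegrable (circleEnergy u) volume c d := fun hc hcd hd =>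
    intervalIntegrable_circleEnergy hcd hU
      ((Set.prod_mono_left (Set.Icc_subset_Icc hc hd)).trans hsub) (hu.of_le (by norm_num))
  have e1 : normOneSq L 1 u = ∫ t in L..(2 * L), circleEnergy u (t - L) := by
    rw [intervalIntegral.integral_comp_sub_right]
    simp only [normOneSq, circleEnergy]
    congr 1 <;> push_cast <;> ring
  have e2 : normOneSq L 2 u = ∫ t in L..(2 * L), circleEnergy u t := by
    simp only [normOneSq, circleEnergy]
    congr 1
    push_cast
    ring
  have e3 : normOneSq L 3 u = ∫ t in L..(2 * L), circleEnergy u (t + L) := by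
    rw [intervalIntegral.integral_comp_add_right]
    simp only [normOneSq, circleEnergy]
    congr 1 <;> push_cast <;> ring
  have i1 : IntervalIntegrable (fun t => circleEnergy u (t - L)) volume L (2 * L) := by
    have := (hint le_rfl (by linarith) (by linarith) : IntervalIntegrable _ _ 0 L).comp_sub_right L
    convert this using 1 <;> ring
  have i3 : IntervalIntegrable (fun t => circleEnergy u (t + L)) volume L (2 * L) := by
    have := (hint (by linarith) (by linarith) le_rfl :
      IntervalIntegrable _ _ (2 * L) (3 * L)).comp_add_right L
    convert this using 1 <;> ring
  rw [e1, e2, e3, ← intervalIntegral.integral_const_mul, ← intervalIntegral.integral_const_mul,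
    ← intervalIntegral.integral_add (i3.const_mul _) (i1.const_mul _),
    ← intervalIntegral.integral_const_mul]
  refine intervalIntegral.integral_mono_on_of_le_Ioo (by linarith)
    (hint (by linarith) (by linarith) (by linarith))
    (((i3.const_mul _).add (i1.const_mul _)).const_mul _) fun t ht => ?_
  obtain ⟨h1, h2⟩ := ht
  exact circleEnergy_three_point hexp' hexp hU hsub' hu hper hh
    ⟨by linarith, by linarith⟩ ⟨by linarith, by linarith⟩ ⟨by linarith, by linarith⟩
end

section
/- For every C₀ > 0 there exists C > 0 (depending only on C₀) with the following property. Let R > 0, x₀ ∈ ℝ², and let v be a nonnegative C² function on the closed disc of radius 2R centered at x₀ in ℝ², and let f, h be continuous functions on this disc such that −Δv ≤ f v + h pointwise and ∫_{B_{2R}(x₀)} f² dx ≤ C₀ R^{-2}. Then sup_{B_R(x₀)} v ≤ C R^{-1} (∫_{B_{2R}(x₀)} v² dx)^{1/2} + C R (∫_{B_{2R}(x₀)} h² dx)^{1/2}. -/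
open Real MeasureTheory

/-- Partial derivative `∂_i f` on the Euclidean plane. -/
noncomputable def pd2 (i : Fin 2) (f : EuclideanSpace ℝ (Fin 2) → ℝ)
    (x : EuclideanSpace ℝ (Fin 2)) : ℝ :=
  fderiv ℝ f x (EuclideanSpace.single i 1)

/-- The standard Laplacian `Δf = Σᵢ ∂ᵢ∂ᵢ f` on the Euclidean plane. -/
noncomputable def lap2 (f : EuclideanSpace ℝ (Fin 2) → ℝ)
    (x : EuclideanSpace ℝ (Fin 2)) : ℝ :=
  ∑ i, pd2 i (fun y => pd2 i f y) x

/-- The Euclidean plane. -/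
abbrev Plane := EuclideanSpace ℝ (Fin 2)

/-- The radial weight `max 0 (1 - ‖z‖²)`, supported in the closed unit disc. -/
noncomputable def hat (z : Plane) : ℝ := max 0 (1 - ‖z‖ ^ 2)

lemma hat_nonneg (z : Plane) : 0 ≤ hat z := le_max_left _ _

lemma hat_le_one (z : Plane) : hat z ≤ 1 :=
  max_le zero_le_one (by nlinarith [sq_nonneg ‖z‖])

lemma hat_eq_zero {z : Plane} (hz : z ∉ Metric.closedBall (0 : Plane) 1) : hat z = 0 := by
  rw [mem_closedBall_zero_iff, not_le] at hz
  exact max_eq_left (by nlinarith)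

lemma continuous_hat : Continuous hat := by
  unfold hat
  fun_prop

lemma hasCompactSupport_hat : HasCompactSupport hat :=
  HasCompactSupport.intro (isCompact_closedBall _ _) fun _ hz => hat_eq_zero hz

lemma integral_hat_pos : 0 < ∫ z, hat z :=
  continuous_hat.integral_pos_of_hasCompactSupport_nonneg_nonzero (x := 0)
    hasCompactSupport_hat hat_nonneg (by simp [hat])

lemma hasDerivAt_max_zero_sq (t : ℝ) :
    HasDerivAt (fun t : ℝ => max 0 t ^ 2) (2 * max 0 t) t := by
  rcases lt_trichotomy t 0 with ht | rfl | ht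
  · rw [max_eq_left ht.le, mul_zero]
    refine (hasDerivAt_const t (0 : ℝ)).congr_of_eventuallyEq ?_
    filter_upwards [Iio_mem_nhds ht] with y hy
    simp [max_eq_left (Set.mem_Iio.1 hy).le]
  · rw [hasDerivAt_iff_isLittleO_nhds_zero]
    simp only [max_self, mul_zero, zero_add, smul_zero, sub_zero, ne_eq, OfNat.ofNat_ne_zero,
      not_false_eq_true, zero_pow]
    refine Asymptotics.IsBigO.trans_isLittleO (g := fun h : ℝ => h ^ 2) ?_
      (Asymptotics.isLittleO_pow_id one_lt_two)
    refine Asymptotics.isBigO_of_le _ fun y => ?_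
    rw [norm_pow, norm_pow]
    gcongr
    rcases le_total 0 y with hy | hy <;> simp [hy]
  · rw [max_eq_right ht.le]
    have := hasDerivAt_pow 2 t
    simp only [Nat.cast_ofNat, Nat.add_one_sub_one, pow_one] at this
    refine this.congr_of_eventuallyEq ?_
    filter_upwards [Ioi_mem_nhds ht] with y hy
    simp [max_eq_right (Set.mem_Ioi.1 hy).le]

lemma hasFDerivAt_hat_sq (z : Plane) :
    HasFDerivAt (fun z => hat z ^ 2) ((-4 * hat z) • innerSL ℝ z) z := by
  have h₁ : HasFDerivAt (fun z : Plane => 1 - ‖z‖ ^ 2) (-(2 • innerSL ℝ z)) z :=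
    (hasStrictFDerivAt_norm_sq z).hasFDerivAt.const_sub 1
  refine ((hasDerivAt_max_zero_sq _).comp_hasFDerivAt z h₁).congr_fderiv ?_
  ext y
  simp [hat]
  ring

lemma contDiff_pd2 {u : Plane → ℝ} (hu : ContDiff ℝ 2 u) (i : Fin 2) : ContDiff ℝ 1 (pd2 i u) :=
  (hu.fderiv_right (m := 1) (by norm_num)).clm_apply contDiff_const

lemma continuous_pd2 {u : Plane → ℝ} (hu : ContDiff ℝ 1 u) (i : Fin 2) : Continuous (pd2 i u) :=
  (hu.continuous_fderiv one_ne_zero).clm_apply continuous_const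

lemma continuous_lap2 {u : Plane → ℝ} (hu : ContDiff ℝ 2 u) : Continuous (lap2 u) :=
  continuous_finsetSum _ fun i _ => continuous_pd2 (contDiff_pd2 hu i) i

lemma integrable_hat_mul {g : Plane → ℝ} (hg : Continuous g) :
    Integrable (fun z => hat z * g z) :=
  (continuous_hat.mul hg).integrable_of_hasCompactSupport hasCompactSupport_hat.mul_right

/-- The weighted means of `u` over discs may be differentiated in the radius. -/
lemma hasDerivAt_integral_hat_mul {u : Plane → ℝ} (hu : ContDiff ℝ 1 u)
    (hc : HasCompactSupport u) (x : Plane) (s : ℝ) :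
    HasDerivAt (fun s : ℝ => ∫ z, hat z * u (x + s • z))
      (∫ z, hat z * fderiv ℝ u (x + s • z) z) s := by
  have hu' : Continuous (fderiv ℝ u) := hu.continuous_fderiv one_ne_zero
  obtain ⟨M, hM⟩ := (hc.fderiv ℝ).exists_bound_of_continuous hu'
  have hcont : ∀ s : ℝ, Continuous fun z : Plane => u (x + s • z) := fun s =>
    hu.continuous.comp (by fun_prop)
  have hcont' : Continuous fun z : Plane => fderiv ℝ u (x + s • z) z :=
    (hu'.comp (by fun_prop : Continuous fun z : Plane => x + s • z)).clm_apply continuous_id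
  refine (hasDerivAt_integral_of_dominated_loc_of_deriv_le (s := Set.univ)
    (F' := fun s z => hat z * fderiv ℝ u (x + s • z) z)
    (bound := fun z => hat z * (M * ‖z‖)) Filter.univ_mem
    (.of_forall fun t => (integrable_hat_mul (hcont t)).aestronglyMeasurable)
    (integrable_hat_mul (hcont s)) (integrable_hat_mul hcont').aestronglyMeasurable
    (.of_forall fun z t _ => ?_) (integrable_hat_mul (by fun_prop))
    (.of_forall fun z t _ => ?_)).2
  · rw [norm_mul, Real.norm_of_nonneg (hat_nonneg z)]
    exact mul_le_mul_of_nonneg_left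
      (ContinuousLinearMap.le_of_opNorm_le _ (hM _) z) (hat_nonneg z)
  · have h₁ : HasDerivAt (fun t : ℝ => x + t • z) z t := by
      simpa using ((hasDerivAt_id t).smul_const z).const_add x
    exact (((hu.differentiable one_ne_zero _).hasFDerivAt).comp_hasDerivAt t h₁).const_mul _

/-- Integration by parts against `hat ^ 2` in a coordinate direction. -/
lemma integral_hat_mul_coord {g : Plane → ℝ} (hg : ContDiff ℝ 1 g) (x : Plane) (s : ℝ)
    (i : Fin 2) :
    ∫ z, hat z * (z i * g (x + s • z)) = s / 4 * ∫ z, hat z ^ 2 * pd2 i g (x + s • z) := by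
  have hfd : ∀ z : Plane, fderiv ℝ (fun z => hat z ^ 2) z (EuclideanSpace.single i 1)
      = -4 * hat z * z i := fun z => by
    rw [(hasFDerivAt_hat_sq z).fderiv]
    simp [EuclideanSpace.inner_single_right]
  have hgd : ∀ z : Plane, HasFDerivAt (fun z : Plane => g (x + s • z))
      (s • fderiv ℝ g (x + s • z)) z := fun z => by
    have h₁ : HasFDerivAt (fun z : Plane => x + s • z) (s • ContinuousLinearMap.id ℝ Plane) z :=
      ((hasFDerivAt_id z).const_smul s).const_add x
    refine (((hg.differentiable one_ne_zero _).hasFDerivAt).comp z h₁).congr_fderiv ?_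
    ext y
    simp
  have hgd' : ∀ z : Plane, fderiv ℝ (fun z : Plane => g (x + s • z)) z
      (EuclideanSpace.single i 1) = s * pd2 i g (x + s • z) := fun z => by
    rw [(hgd z).fderiv]
    simp [pd2]
  have hgc : Continuous fun z : Plane => g (x + s • z) := hg.continuous.comp (by fun_prop)
  have hpc : Continuous fun z : Plane => pd2 i g (x + s • z) :=
    (continuous_pd2 hg i).comp (by fun_prop)
  have key := integral_mul_fderiv_eq_neg_fderiv_mul_of_integrable (μ := volume)
    (f := fun z : Plane => hat z ^ 2) (g := fun z : Plane => g (x + s • z))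
    (v := EuclideanSpace.single i 1) ?_ ?_ ?_
    (fun z _ => (hasFDerivAt_hat_sq z).differentiableAt) (fun z _ => (hgd z).differentiableAt)
  · simp only [hfd, hgd'] at key
    have h₁ : ∀ z : Plane, hat z ^ 2 * (s * pd2 i g (x + s • z))
        = s * (hat z ^ 2 * pd2 i g (x + s • z)) := fun z => by ring
    have h₂ : ∀ z : Plane, -4 * hat z * z i * g (x + s • z)
        = -4 * (hat z * (z i * g (x + s • z))) := fun z => by ring
    simp only [h₁, h₂, integral_const_mul] at key
    linarith
  · simp only [hfd]
    refine (integrable_hat_mul (g := fun z : Plane => -4 * z i * g (x + s • z))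
      (by fun_prop)).congr (.of_forall fun z => ?_)
    ring
  · simp only [hgd']
    refine (integrable_hat_mul (g := fun z : Plane => hat z * (s * pd2 i g (x + s • z)))
      (continuous_hat.mul (by fun_prop))).congr (.of_forall fun z => ?_)
    ring
  · refine (integrable_hat_mul (g := fun z : Plane => hat z * g (x + s • z))
      (continuous_hat.mul (by fun_prop))).congr (.of_forall fun z => ?_)
    ring

lemma integral_hat_mul_fderiv {u : Plane → ℝ} (hu : ContDiff ℝ 2 u) (x : Plane) (s : ℝ) :
    ∫ z, hat z * fderiv ℝ u (x + s • z) z = s / 4 * ∫ z, hat z ^ 2 * lap2 u (x + s • z) := by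
  have h₁ : ∀ z : Plane, hat z * fderiv ℝ u (x + s • z) z
      = ∑ i, hat z * (z i * pd2 i u (x + s • z)) := fun z => by
    have hz : z = ∑ i, z i • EuclideanSpace.single i (1 : ℝ) := by
      ext j
      fin_cases j <;> simp
    conv_lhs => rw [hz, map_sum, ← hz]
    simp [mul_add, pd2]
  have h₂ : ∀ z : Plane, hat z ^ 2 * lap2 u (x + s • z)
      = ∑ i, hat z ^ 2 * pd2 i (pd2 i u) (x + s • z) := fun z => by
    rw [lap2, Finset.mul_sum]
  have hc₁ : ∀ i, Continuous fun z : Plane => pd2 i u (x + s • z) := fun i =>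
    (contDiff_pd2 hu i).continuous.comp (by fun_prop)
  have hc₂ : ∀ i, Continuous fun z : Plane => pd2 i (pd2 i u) (x + s • z) := fun i =>
    (continuous_pd2 (contDiff_pd2 hu i) i).comp (by fun_prop)
  simp only [h₁, h₂]
  rw [integral_finsetSum, integral_finsetSum, Finset.mul_sum]
  · exact Finset.sum_congr rfl fun i _ => integral_hat_mul_coord (contDiff_pd2 hu i) x s i
  · intro i _
    refine (integrable_hat_mul (g := fun z => hat z * pd2 i (pd2 i u) (x + s • z))
      (continuous_hat.mul (hc₂ i))).congr (.of_forall fun z => ?_)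
    ring
  · intro i _
    have := hc₁ i
    exact integrable_hat_mul (by fun_prop)

lemma mapsTo_disc {x : Plane} {s : ℝ} (hs : 0 ≤ s) :
    Set.MapsTo (fun z : Plane => x + s • z) (Metric.closedBall 0 1) (Metric.closedBall x s) := by
  intro z hz
  rw [mem_closedBall_zero_iff] at hz
  rw [mem_closedBall_iff_norm, add_sub_cancel_left, norm_smul, Real.norm_of_nonneg hs]
  nlinarith

lemma setIntegral_disc (g : Plane → ℝ) (x : Plane) {s : ℝ} (hs : 0 < s) :
    ∫ z in Metric.closedBall (0 : Plane) 1, g (x + s • z)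
      = (s ^ 2)⁻¹ * ∫ y in Metric.closedBall x s, g y := by
  rw [Measure.setIntegral_comp_smul_of_pos volume (fun y => g (x + y)) _ hs,
    finrank_euclideanSpace_fin, smul_eq_mul, smul_unitClosedBall, Real.norm_of_nonneg hs.le,
    ← (measurePreserving_add_left volume x).setIntegral_preimage_emb
      (measurableEmbedding_addLeft x) g (Metric.closedBall x s)]
  simp

/-- The `L¹` norm is controlled by the `L²` norm on a set of finite measure. -/
lemma setIntegral_le_sqrt_mul_sqrt {S : Set Plane} (hS : IsCompact S) {g : Plane → ℝ}
    (hg : ContinuousOn g S) :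
    ∫ y in S, g y ≤ √(volume.real S) * √(∫ y in S, g y ^ 2) := by
  have hfin : volume S ≠ ⊤ := hS.measure_lt_top.ne
  rw [← Real.sqrt_mul measureReal_nonneg]
  refine Real.le_sqrt_of_sq_le ?_
  rcases eq_or_lt_of_le (measureReal_nonneg (μ := volume) (s := S)) with h₀ | h₀
  · have : volume S = 0 := by
      rwa [eq_comm, measureReal_eq_zero_iff hfin] at h₀
    simp [setIntegral_measure_zero _ this]
  have hi₁ : IntegrableOn g S := hg.integrableOn_compact hS
  have hi₂ : IntegrableOn (fun y => g y ^ 2) S := (hg.pow 2).integrableOn_compact hS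
  set V := volume.real S with hV
  set I := ∫ y in S, g y with hI
  have h₁ : 0 ≤ ∫ y in S, (V * g y - I) ^ 2 := integral_nonneg fun y => sq_nonneg _
  have h₂ : ∫ y in S, (V * g y - I) ^ 2
      = V ^ 2 * (∫ y in S, g y ^ 2) - 2 * V * I * I + V * I ^ 2 := by
    have : ∀ y, (V * g y - I) ^ 2 = V ^ 2 * g y ^ 2 - 2 * V * I * g y + I ^ 2 := fun y => by ring
    simp only [this]
    have hconst : IntegrableOn (fun _ => I ^ 2) S := integrableOn_const hfin
    rw [integral_add (f := fun y => V ^ 2 * g y ^ 2 - 2 * V * I * g y)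
      ((hi₂.const_mul _).sub (hi₁.const_mul _)) hconst, integral_sub (hi₂.const_mul _) (hi₁.const_mul _),
      integral_const_mul, integral_const_mul, setIntegral_const, smul_eq_mul]
  rw [h₂] at h₁
  have h₃ : 0 ≤ V * (V * (∫ y in S, g y ^ 2) - I ^ 2) := by linarith
  linarith [nonneg_of_mul_nonneg_right h₃ h₀]

/-- The square root of the area of the unit disc. -/
noncomputable def sqrtArea : ℝ := √(volume.real (Metric.closedBall (0 : Plane) 1))

lemma setIntegral_disc_le {g : Plane → ℝ} {x : Plane} {s r : ℝ} (hs : 0 < s) (hsr : s ≤ r)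
    (hg : ContinuousOn g (Metric.closedBall x r)) :
    ∫ z in Metric.closedBall (0 : Plane) 1, g (x + s • z)
      ≤ sqrtArea * (s⁻¹ * √(∫ y in Metric.closedBall x r, g y ^ 2)) := by
  have hsub := Metric.closedBall_subset_closedBall (x := x) hsr
  refine (setIntegral_le_sqrt_mul_sqrt (isCompact_closedBall _ _)
    ((hg.mono hsub).comp (by fun_prop) (mapsTo_disc hs.le))).trans ?_
  refine mul_le_mul_of_nonneg_left ?_ (Real.sqrt_nonneg _)
  simp only [Function.comp_apply]
  rw [setIntegral_disc (fun y => g y ^ 2) x hs, Real.sqrt_mul (by positivity), Real.sqrt_inv,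
    Real.sqrt_sq hs.le]
  have hi : IntegrableOn (fun y => g y ^ 2) (Metric.closedBall x r) :=
    (hg.pow 2).integrableOn_compact (isCompact_closedBall _ _)
  exact mul_le_mul_of_nonneg_left (Real.sqrt_le_sqrt (setIntegral_mono_set hi
    (.of_forall fun y => sq_nonneg _) (.of_forall hsub))) (inv_nonneg.2 hs.le)

/-- Mean value inequality: a quantitative form of the sub-mean-value property for functions whose
Laplacian is bounded below by `-g`. -/
lemma mean_value_inequality {u g : Plane → ℝ} {x : Plane} {r : ℝ} (hr : 0 < r)
    (hu : ContDiff ℝ 2 u) (hc : HasCompactSupport u)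
    (hu₀ : ∀ y ∈ Metric.closedBall x r, 0 ≤ u y)
    (hg : ContinuousOn g (Metric.closedBall x r)) (hg₀ : ∀ y ∈ Metric.closedBall x r, 0 ≤ g y)
    (hlap : ∀ y ∈ Metric.closedBall x r, -(lap2 u y) ≤ g y) :
    (∫ z, hat z) * u x ≤ sqrtArea * (r⁻¹ * √(∫ y in Metric.closedBall x r, u y ^ 2))
      + r * (sqrtArea / 4 * √(∫ y in Metric.closedBall x r, g y ^ 2)) := by
  have hu₁ : ContDiff ℝ 1 u := hu.of_le (by norm_num)
  have hderiv := hasDerivAt_integral_hat_mul hu₁ hc x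
  set K := sqrtArea / 4 * √(∫ y in Metric.closedBall x r, g y ^ 2) with hK
  have hbound : ∀ s ∈ Set.Ioo 0 r, -K ≤ ∫ z, hat z * fderiv ℝ u (x + s • z) z := by
    intro s ⟨hs, hsr⟩
    have hmaps : ∀ z ∈ Metric.closedBall (0 : Plane) 1, x + s • z ∈ Metric.closedBall x r :=
      fun z hz => Metric.closedBall_subset_closedBall hsr.le (mapsTo_disc hs.le hz)
    have hlc : Continuous fun z : Plane => lap2 u (x + s • z) :=
      (continuous_lap2 hu).comp (by fun_prop)
    have h₁ : ∫ z in Metric.closedBall (0 : Plane) 1, -g (x + s • z)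
        ≤ ∫ z in Metric.closedBall (0 : Plane) 1, hat z ^ 2 * lap2 u (x + s • z) := by
      refine setIntegral_mono_on ?_ ?_ measurableSet_closedBall fun z hz => ?_
      · exact (ContinuousOn.neg (hg.comp (by fun_prop) hmaps)).integrableOn_compact
          (isCompact_closedBall _ _)
      · exact ((continuous_hat.pow 2).mul hlc).continuousOn.integrableOn_compact
          (isCompact_closedBall _ _)
      · have h₂ := hlap _ (hmaps z hz)
        have h₃ := hg₀ _ (hmaps z hz)
        have h₄ : hat z ^ 2 ≤ 1 := pow_le_one₀ (hat_nonneg z) (hat_le_one z)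
        nlinarith [sq_nonneg (hat z)]
    rw [integral_neg, setIntegral_eq_integral_of_forall_compl_eq_zero
      (f := fun z => hat z ^ 2 * lap2 u (x + s • z))
      (fun z hz => by simp [hat_eq_zero hz])] at h₁
    have h₂ := setIntegral_disc_le hs hsr.le hg
    rw [integral_hat_mul_fderiv hu]
    have h₃ : K = s / 4 * (sqrtArea * (s⁻¹ * √(∫ y in Metric.closedBall x r, g y ^ 2))) := by
      rw [hK]
      field_simp
    rw [h₃, ← mul_neg]
    exact mul_le_mul_of_nonneg_left (by linarith) (by positivity)
  have hmono := (convex_Icc 0 r).mul_sub_le_image_sub_of_le_deriv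
    (fun s _ => (hderiv s).continuousAt.continuousWithinAt)
    (fun s _ => (hderiv s).differentiableAt.differentiableWithinAt) (C := -K)
    (fun s hs => by
      rw [interior_Icc] at hs
      rw [(hderiv s).deriv]
      exact hbound s hs)
    0 (Set.left_mem_Icc.2 hr.le) r (Set.right_mem_Icc.2 hr.le) hr.le
  have hend : ∫ z, hat z * u (x + r • z)
      ≤ sqrtArea * (r⁻¹ * √(∫ y in Metric.closedBall x r, u y ^ 2)) := by
    refine le_trans ?_ (setIntegral_disc_le hr le_rfl hu.continuous.continuousOn)
    rw [← setIntegral_eq_integral_of_forall_compl_eq_zero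
      (s := Metric.closedBall (0 : Plane) 1) (fun z hz => by simp [hat_eq_zero hz])]
    have hcu : Continuous fun z : Plane => u (x + r • z) := hu.continuous.comp (by fun_prop)
    refine setIntegral_mono_on ?_ ?_ measurableSet_closedBall fun z hz => ?_
    · exact (continuous_hat.mul hcu).continuousOn.integrableOn_compact (isCompact_closedBall _ _)
    · exact hcu.continuousOn.integrableOn_compact (isCompact_closedBall _ _)
    · exact mul_le_of_le_one_left (hu₀ _ (mapsTo_disc hr.le hz)) (hat_le_one z)
  simp only [zero_smul, add_zero, integral_mul_const] at hmono
  linarith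

lemma pd2_congr {u v : Plane → ℝ} {y : Plane} (h : u =ᶠ[nhds y] v) (i : Fin 2) :
    pd2 i u y = pd2 i v y := by
  unfold pd2
  rw [h.fderiv_eq]

lemma lap2_congr {u v : Plane → ℝ} {y : Plane} (h : u =ᶠ[nhds y] v) : lap2 u y = lap2 v y :=
  Finset.sum_congr rfl fun i _ =>
    pd2_congr (h.eventuallyEq_nhds.mono fun _ hz => pd2_congr hz i) i

/-- A function that is `C²` on an open disc agrees near any smaller concentric closed disc with a
compactly supported `C²` function on the plane. -/
lemma exists_contDiff_hasCompactSupport_eventuallyEq {v : Plane → ℝ} {x : Plane} {r d : ℝ}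
    (hr : 0 < r) (hrd : r < d) (hv : ContDiffOn ℝ 2 v (Metric.ball x d)) :
    ∃ u : Plane → ℝ, ContDiff ℝ 2 u ∧ HasCompactSupport u ∧
      ∀ y ∈ Metric.closedBall x r, u =ᶠ[nhds y] v := by
  obtain ⟨a, hra, had⟩ := exists_between hrd
  obtain ⟨b, hab, hbd⟩ := exists_between had
  let χ : ContDiffBump x := ⟨a, b, hr.trans hra, hab⟩
  refine ⟨fun y => χ y * v y, contDiff_iff_contDiffAt.2 fun y => ?_, χ.hasCompactSupport.mul_right,
    fun y hy => ?_⟩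
  · by_cases hy : y ∈ Metric.ball x d
    · exact χ.contDiffAt.mul (hv.contDiffAt (Metric.isOpen_ball.mem_nhds hy))
    · have hy' : y ∉ tsupport χ := fun h => by
        rw [χ.tsupport_eq] at h
        exact hy (Metric.closedBall_subset_ball hbd h)
      refine (contDiffAt_const (c := (0 : ℝ))).congr_of_eventuallyEq ?_
      filter_upwards [(isClosed_tsupport χ).isOpen_compl.mem_nhds hy'] with z hz
      rw [image_eq_zero_of_notMem_tsupport hz, zero_mul]
  · filter_upwards [Metric.isOpen_ball.mem_nhds (Metric.closedBall_subset_ball hra hy)] with z hz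
    rw [χ.one_of_mem_closedBall (Metric.ball_subset_closedBall hz), one_mul]

/-- Local estimate on a disc `B_r(x)` on which `v ≤ N`. -/
lemma local_bound {v f h : Plane → ℝ} {x : Plane} {r d N : ℝ} (hr : 0 < r) (hrd : r < d)
    (hN : 0 ≤ N) (hv : ContDiffOn ℝ 2 v (Metric.ball x d))
    (hv₀ : ∀ y ∈ Metric.closedBall x r, 0 ≤ v y) (hvN : ∀ y ∈ Metric.closedBall x r, v y ≤ N)
    (hf : ContinuousOn f (Metric.closedBall x r)) (hh : ContinuousOn h (Metric.closedBall x r))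
    (hlap : ∀ y ∈ Metric.closedBall x r, -(lap2 v y) ≤ f y * v y + h y) :
    (∫ z, hat z) * v x ≤ sqrtArea * (r⁻¹ * √(∫ y in Metric.closedBall x r, v y ^ 2))
      + r * (sqrtArea / 2 * (N * √(∫ y in Metric.closedBall x r, f y ^ 2)
        + √(∫ y in Metric.closedBall x r, h y ^ 2))) := by
  obtain ⟨u, hu, hc, huv⟩ := exists_contDiff_hasCompactSupport_eventuallyEq hr hrd hv
  have heq : ∀ y ∈ Metric.closedBall x r, u y = v y := fun y hy => (huv y hy).self_of_nhds
  have hK := isCompact_closedBall x r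
  have hmv := mean_value_inequality (g := fun y => |f y| * N + |h y|) hr hu hc
    (fun y hy => by rw [heq y hy]; exact hv₀ y hy) ((hf.abs.mul continuousOn_const).add hh.abs)
    (fun y _ => by positivity) (fun y hy => by
      rw [lap2_congr (huv y hy)]
      refine (hlap y hy).trans (add_le_add ?_ (le_abs_self _))
      exact mul_le_mul (le_abs_self _) (hvN y hy) (hv₀ y hy) (abs_nonneg _))
  rw [heq x (Metric.mem_closedBall_self hr.le),
    setIntegral_congr_fun measurableSet_closedBall (g := fun y => v y ^ 2)
      (fun y hy => by simp only [heq y hy])] at hmv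
  refine hmv.trans ?_
  set F := ∫ y in Metric.closedBall x r, f y ^ 2 with hF
  set H := ∫ y in Metric.closedBall x r, h y ^ 2 with hH
  have hF₀ : 0 ≤ F := integral_nonneg fun y => sq_nonneg _
  have hH₀ : 0 ≤ H := integral_nonneg fun y => sq_nonneg _
  have hle : ∫ y in Metric.closedBall x r, (|f y| * N + |h y|) ^ 2
      ≤ 2 * N ^ 2 * F + 2 * H := by
    have hi₁ : IntegrableOn (fun y => f y ^ 2) (Metric.closedBall x r) :=
      (hf.pow 2).integrableOn_compact hK
    have hi₂ : IntegrableOn (fun y => h y ^ 2) (Metric.closedBall x r) :=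
      (hh.pow 2).integrableOn_compact hK
    rw [hF, hH, ← integral_const_mul, ← integral_const_mul,
      ← integral_add (hi₁.const_mul _) (hi₂.const_mul _)]
    refine setIntegral_mono_on ?_ ((hi₁.const_mul _).add (hi₂.const_mul _))
      measurableSet_closedBall fun y _ => ?_
    · exact (((hf.abs.mul continuousOn_const).add hh.abs).pow 2).integrableOn_compact hK
    · nlinarith [sq_nonneg (|f y| * N - |h y|), sq_abs (f y), sq_abs (h y)]
  have hsqrt : √(∫ y in Metric.closedBall x r, (|f y| * N + |h y|) ^ 2)
      ≤ 2 * (N * √F + √H) := by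
    refine Real.sqrt_le_iff.2 ⟨by positivity, hle.trans ?_⟩
    nlinarith [Real.sq_sqrt hF₀, Real.sq_sqrt hH₀,
      mul_nonneg (mul_nonneg hN (Real.sqrt_nonneg F)) (Real.sqrt_nonneg H),
      mul_nonneg (sq_nonneg N) hF₀]
  have hA : 0 ≤ sqrtArea := Real.sqrt_nonneg _
  have : sqrtArea / 4 * √(∫ y in Metric.closedBall x r, (|f y| * N + |h y|) ^ 2)
      ≤ sqrtArea / 2 * (N * √F + √H) := by nlinarith
  gcongr

/-- Moser-iteration sup bound on the plane: for every `C₀ > 0` there is `C > 0` such that any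
nonnegative `C²` function `v` on `B_{2R}(x₀) ⊂ ℝ²` with `−Δv ≤ f v + h` and
`∫_{B_{2R}} f² ≤ C₀ R⁻²` satisfies
`sup_{B_R} v ≤ C R⁻¹ ‖v‖_{L²(B_{2R})} + C R ‖h‖_{L²(B_{2R})}`. -/
theorem moser_iteration_plane (C₀ : ℝ) (hC₀ : 0 < C₀) :
    ∃ C : ℝ, 0 < C ∧
      ∀ (R : ℝ) (x₀ : EuclideanSpace ℝ (Fin 2))
        (v f h : EuclideanSpace ℝ (Fin 2) → ℝ),
        0 < R →
        ContDiffOn ℝ 2 v (Metric.closedBall x₀ (2 * R)) →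
        (∀ x ∈ Metric.closedBall x₀ (2 * R), 0 ≤ v x) →
        ContinuousOn f (Metric.closedBall x₀ (2 * R)) →
        ContinuousOn h (Metric.closedBall x₀ (2 * R)) →
        (∀ x ∈ Metric.closedBall x₀ (2 * R), -(lap2 v x) ≤ f x * v x + h x) →
        (∫ x in Metric.closedBall x₀ (2 * R), (f x) ^ 2) ≤ C₀ * R ^ (-2 : ℤ) →
        ∀ x ∈ Metric.closedBall x₀ R,
          v x ≤ C * R⁻¹ * Real.sqrt (∫ y in Metric.closedBall x₀ (2 * R), (v y) ^ 2) +
                C * R * Real.sqrt (∫ y in Metric.closedBall x₀ (2 * R), (h y) ^ 2) := by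
  have hc := integral_hat_pos
  have hA : 0 ≤ sqrtArea := Real.sqrt_nonneg _
  have hloc := @local_bound
  generalize (∫ z, hat z) = c at hc hloc
  generalize sqrtArea = A at hA hloc
  obtain ⟨δ, hδ⟩ : ∃ δ, δ = c / (4 * A * √C₀ + 2 * c) := ⟨_, rfl⟩
  have hden : 0 < 4 * A * √C₀ + 2 * c := by positivity
  have hδ₀ : 0 < δ := hδ ▸ div_pos hc hden
  have hδ₁ : δ * (4 * A * √C₀ + 2 * c) = c := by rw [hδ, div_mul_cancel₀ _ hden.ne']
  have hδ₂ : δ ≤ 1 / 2 := by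
    rw [hδ, div_le_iff₀ hden]
    nlinarith [mul_nonneg hA (Real.sqrt_nonneg C₀)]
  have hδ₃ : 2 * δ * A * √C₀ ≤ c / 2 := by nlinarith
  refine ⟨2 * (A / δ) / c + 4 * δ * A / c + 1, by positivity, ?_⟩
  intro R x₀ v f h hR hv hv₀ hf hh hlap hfC
  have hS := isCompact_closedBall x₀ (2 * R)
  have hF : √(∫ y in Metric.closedBall x₀ (2 * R), f y ^ 2) ≤ √C₀ / R := by
    refine (Real.sqrt_le_sqrt hfC).trans_eq ?_
    rw [Real.sqrt_mul hC₀.le, zpow_neg, Real.sqrt_inv]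
    norm_cast
    rw [Real.sqrt_sq hR.le, div_eq_mul_inv]
  obtain ⟨V, hV⟩ : ∃ V, V = √(∫ y in Metric.closedBall x₀ (2 * R), v y ^ 2) := ⟨_, rfl⟩
  obtain ⟨H, hH⟩ : ∃ H, H = √(∫ y in Metric.closedBall x₀ (2 * R), h y ^ 2) := ⟨_, rfl⟩
  have hV₀ : 0 ≤ V := hV ▸ Real.sqrt_nonneg _
  have hH₀ : 0 ≤ H := hH ▸ Real.sqrt_nonneg _
  rw [← hV, ← hH]
  obtain ⟨x, hx, hmax⟩ := hS.exists_isMaxOn (f := fun y => (2 * R - dist y x₀) * v y)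
    ⟨x₀, Metric.mem_closedBall_self (by positivity)⟩
    (ContinuousOn.mul (by fun_prop) hv.continuousOn)
  obtain ⟨d, hd⟩ : ∃ d, d = 2 * R - dist x x₀ := ⟨_, rfl⟩
  obtain ⟨M, hM⟩ : ∃ M, M = d * v x := ⟨_, rfl⟩
  have hmaxM : ∀ y ∈ Metric.closedBall x₀ (2 * R), (2 * R - dist y x₀) * v y ≤ M := fun y hy => by
    rw [hM, hd]
    exact hmax hy
  have hd₀ : 0 ≤ d := by
    rw [hd]
    linarith [Metric.mem_closedBall.1 hx]
  have hd₂ : d ≤ 2 * R := by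
    rw [hd]
    linarith [dist_nonneg (x := x) (y := x₀)]
  have hM₀ : 0 ≤ M := hM ▸ mul_nonneg hd₀ (hv₀ x hx)
  have hMle : c / 2 * M ≤ A / δ * V + 2 * δ * R ^ 2 * A * H := by
    rcases hd₀.eq_or_lt with hd0 | hd0
    · rw [hM, ← hd0, zero_mul, mul_zero]
      positivity
    have hr : 0 < δ * d := mul_pos hδ₀ hd0
    have hrd : δ * d < d := by nlinarith
    have hball : Metric.ball x d ⊆ Metric.closedBall x₀ (2 * R) := fun y hy => by
      rw [Metric.mem_ball] at hy
      rw [Metric.mem_closedBall]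
      linarith [dist_triangle y x x₀]
    have hsub : Metric.closedBall x (δ * d) ⊆ Metric.closedBall x₀ (2 * R) :=
      (Metric.closedBall_subset_ball hrd).trans hball
    have hmono : ∀ g : Plane → ℝ, ContinuousOn g (Metric.closedBall x₀ (2 * R)) →
        √(∫ y in Metric.closedBall x (δ * d), g y ^ 2)
          ≤ √(∫ y in Metric.closedBall x₀ (2 * R), g y ^ 2) := fun g hg =>
      Real.sqrt_le_sqrt (setIntegral_mono_set ((hg.pow 2).integrableOn_compact hS)
        (.of_forall fun y => sq_nonneg _) (.of_forall hsub))
    have hN : ∀ y ∈ Metric.closedBall x (δ * d), v y ≤ 2 * M / d := fun y hy => by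
      have h₁ := hmaxM y (hsub hy)
      have h₂ : d / 2 ≤ 2 * R - dist y x₀ := by
        rw [Metric.mem_closedBall] at hy
        nlinarith [dist_triangle y x x₀]
      rw [le_div_iff₀ hd0]
      nlinarith [mul_le_mul_of_nonneg_right h₂ (hv₀ y (hsub hy))]
    have key := hloc hr hrd (by positivity) (hv.mono hball) (fun y hy => hv₀ y (hsub hy)) hN
      (hf.mono hsub) (hh.mono hsub) (fun y hy => hlap y (hsub hy))
    have h₁ : c * v x ≤ A * ((δ * d)⁻¹ * V) + δ * d * (A / 2 * (2 * M / d * (√C₀ / R) + H)) := by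
      refine key.trans ?_
      have hfm := (hmono f hf).trans hF
      have hvm := hV ▸ hmono v hv.continuousOn
      have hhm := hH ▸ hmono h hh
      gcongr
    have h₂ : c * M ≤ A / δ * V + δ * A * M * √C₀ * (d / R) + δ * d ^ 2 * A / 2 * H := by
      calc c * M = d * (c * v x) := by rw [hM]; ring
        _ ≤ d * (A * ((δ * d)⁻¹ * V) + δ * d * (A / 2 * (2 * M / d * (√C₀ / R) + H))) :=
          mul_le_mul_of_nonneg_left h₁ hd₀
        _ = _ := by field_simp; ring
    have h₃ : δ * A * M * √C₀ * (d / R) ≤ δ * A * M * √C₀ * 2 := by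
      gcongr
      rwa [div_le_iff₀ hR]
    have h₄ : δ * d ^ 2 * A / 2 * H ≤ δ * (2 * R) ^ 2 * A / 2 * H := by gcongr
    linarith [mul_le_mul_of_nonneg_right hδ₃ hM₀]
  intro y hy
  have hyR : R * v y ≤ M := by
    have hy₂ := Metric.closedBall_subset_closedBall (by linarith : R ≤ 2 * R) hy
    refine le_trans ?_ (hmaxM y hy₂)
    exact mul_le_mul_of_nonneg_right (by linarith [Metric.mem_closedBall.1 hy]) (hv₀ y hy₂)
  have h₁ : v y ≤ 2 * (A / δ) / c * R⁻¹ * V + 4 * δ * A / c * R * H := by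
    have h₂ : v y ≤ M / R := by rwa [le_div_iff₀' hR]
    have h₃ : M ≤ 2 / c * (A / δ * V + 2 * δ * R ^ 2 * A * H) := by
      rw [div_mul_eq_mul_div, le_div_iff₀ hc]
      linarith
    refine h₂.trans ((div_le_div_of_nonneg_right h₃ hR.le).trans_eq ?_)
    field_simp
    ring
  refine h₁.trans (add_le_add ?_ ?_)
  · gcongr
    have : 0 ≤ 4 * δ * A / c := by positivity
    linarith
  · gcongr
    have : 0 ≤ 2 * (A / δ) / c := by positivity
    linarith
end

section
/- Let τ ∈ (0,1) and let u be a C² function on {x ∈ ℝ³ : |x| > 1} satisfying |u(x)| ≤ C|x|^{-1} and |Δu(x)| ≤ C|x|^{-3-τ} for all |x| > 1, where Δ is the standard Laplacian on ℝ³. Then there exists a constant c ∈ ℝ such that lim_{|x|→∞} |x|^{1+τ/2} · |u(x) − c/|x|| = 0; that is, u(x) = c/|x| + o(|x|^{-1-τ/2}) as |x| → ∞. -/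
open Real MeasureTheory

/-- Partial derivative `∂_i f` on Euclidean `ℝ³`. -/
noncomputable def pd3 (i : Fin 3) (f : EuclideanSpace ℝ (Fin 3) → ℝ)
    (x : EuclideanSpace ℝ (Fin 3)) : ℝ :=
  fderiv ℝ f x (EuclideanSpace.single i 1)

/-- The standard Laplacian `Δf = Σᵢ ∂ᵢ∂ᵢ f` on Euclidean `ℝ³`. -/
noncomputable def lap3 (f : EuclideanSpace ℝ (Fin 3) → ℝ)
    (x : EuclideanSpace ℝ (Fin 3)) : ℝ :=
  ∑ i, pd3 i (fun y => pd3 i f y) x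

open Filter Topology InnerProductSpace

local notation "E3" => EuclideanSpace ℝ (Fin 3)

/-- The Laplacian is invariant under composition with a linear isometry. -/
lemma laplacian_comp_linearIsometryEquiv (S : E3 ≃ₗᵢ[ℝ] E3) (f : E3 → ℝ) (x : E3) :
    Laplacian.laplacian (f ∘ S) x = Laplacian.laplacian f (S x) := by
  let b := EuclideanSpace.basisFun (Fin 3) ℝ
  rw [laplacian_eq_iteratedFDeriv_orthonormalBasis _ b,
    laplacian_eq_iteratedFDeriv_orthonormalBasis f (b.map S)]
  refine Finset.sum_congr rfl fun i _ => ?_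
  have h := S.toContinuousLinearEquiv.iteratedFDerivWithin_comp_right f uniqueDiffOn_univ
    (Set.mem_univ (S x)) 2
  simp only [Set.preimage_univ, iteratedFDerivWithin_univ] at h
  have h2 : iteratedFDeriv ℝ 2 (f ∘ S) x = _ := h
  rw [h2]
  simp only [ContinuousMultilinearMap.compContinuousLinearMap_apply, OrthonormalBasis.map_apply]
  congr 1
  ext j : 1
  fin_cases j <;> rfl

lemma pd3_pd3_eq_fderiv_fderiv {f : E3 → ℝ} {x : E3} (hf : ContDiffAt ℝ 2 f x) (i : Fin 3) :
    pd3 i (fun y => pd3 i f y) x =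
      fderiv ℝ (fderiv ℝ f) x (EuclideanSpace.single i 1) (EuclideanSpace.single i 1) := by
  have h : DifferentiableAt ℝ (fderiv ℝ f) x :=
    (hf.fderiv_right (m := 1) (by norm_num)).differentiableAt (by norm_num)
  simp only [pd3]
  rw [fderiv_clm_apply h (differentiableAt_const _)]
  simp

lemma lap3_eq_laplacian {f : E3 → ℝ} {x : E3} (hf : ContDiffAt ℝ 2 f x) :
    lap3 f x = Laplacian.laplacian f x := by
  rw [laplacian_eq_iteratedFDeriv_orthonormalBasis _ (EuclideanSpace.basisFun (Fin 3) ℝ)]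
  simp only [lap3, iteratedFDeriv_two_apply, pd3_pd3_eq_fderiv_fderiv hf]
  simp

/-- Second-derivative test: the Laplacian is nonpositive at a local maximum. -/
lemma IsLocalMax.laplacian_nonpos {f : E3 → ℝ} {x : E3} (hmax : IsLocalMax f x)
    (hf : ContDiffAt ℝ 2 f x) : Laplacian.laplacian f x ≤ 0 := by
  rw [← lap3_eq_laplacian hf]
  refine Finset.sum_nonpos fun i _ => ?_
  rw [pd3_pd3_eq_fderiv_fderiv hf]
  set v : E3 := EuclideanSpace.single i 1
  by_contra! hpos
  let γ : ℝ → E3 := fun t => x + t • v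
  have hγ (t : ℝ) : HasDerivAt γ v t := by
    simpa [γ] using ((hasDerivAt_id t).smul_const v).const_add x
  have hγ0 : γ 0 = x := by simp [γ]
  have hγt : Tendsto γ (𝓝 0) (𝓝 x) := by
    simpa only [hγ0] using (hγ 0).continuousAt.tendsto
  have hd : DifferentiableAt ℝ (fderiv ℝ f) x :=
    (hf.fderiv_right (m := 1) (by norm_num)).differentiableAt (by norm_num)
  have hderiv : deriv (f ∘ γ) =ᶠ[𝓝 0] fun t => fderiv ℝ f (γ t) v := by
    filter_upwards [hγt.eventually (hf.eventually (by simp))] with t ht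
    exact ((ht.differentiableAt (by norm_num)).hasFDerivAt.comp_hasDerivAt t (hγ t)).deriv
  have hderiv2 : deriv (deriv (f ∘ γ)) 0 = fderiv ℝ (fderiv ℝ f) x v v := by
    rw [hderiv.deriv_eq]
    have h1 : HasFDerivAt (fderiv ℝ f) (fderiv ℝ (fderiv ℝ f) x) (γ 0) := by
      rw [hγ0]; exact hd.hasFDerivAt
    have h2 := (h1.comp_hasDerivAt (0 : ℝ) (hγ 0)).clm_apply (hasDerivAt_const (0 : ℝ) v)
    simpa using h2.deriv
  have hmaxγ : IsLocalMax (f ∘ γ) 0 := by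
    have := hγt.eventually hmax
    filter_upwards [this] with t ht
    simpa [hγ0] using ht
  have hcont : ContinuousAt (f ∘ γ) 0 :=
    ContinuousAt.comp (by rw [hγ0]; exact hf.continuousAt) (hγ 0).continuousAt
  have hminγ : IsLocalMin (f ∘ γ) 0 :=
    isLocalMin_of_deriv_deriv_pos (by rw [hderiv2]; exact hpos) hmaxγ.deriv_eq_zero hcont
  have hconst : f ∘ γ =ᶠ[𝓝 0] fun _ => (f ∘ γ) 0 := by
    filter_upwards [hmaxγ, hminγ] with t h1 h2 using le_antisymm h1 h2
  have h0 : deriv (deriv (f ∘ γ)) 0 = 0 := by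
    rw [hconst.deriv.deriv_eq]
    simp
  rw [hderiv2] at h0
  exact hpos.ne' h0

/-- Maximum principle on a possibly unbounded closed set, for functions that are strictly
subharmonic wherever they are positive inside the set and vanish at infinity. -/
lemma nonpos_of_laplacian_pos {D : Set E3} (hD : IsClosed D) {f : E3 → ℝ}
    (hcont : ContinuousOn f D)
    (hinf : ∀ ε : ℝ, 0 < ε → ∃ M : ℝ, ∀ x ∈ D, M ≤ ‖x‖ → f x ≤ ε)
    (hint : ∀ x ∈ D, f x ≤ 0 ∨
      (D ∈ 𝓝 x ∧ ContDiffAt ℝ 2 f x ∧ 0 < Laplacian.laplacian f x)) :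
    ∀ x ∈ D, f x ≤ 0 := by
  intro x₀ hx₀
  by_contra! hpos
  obtain ⟨M, hM⟩ := hinf (f x₀ / 2) (by positivity)
  have hcomp : IsCompact (D ∩ Metric.closedBall 0 (max M ‖x₀‖)) :=
    (isCompact_closedBall _ _).inter_left hD
  obtain ⟨z, ⟨hzD, -⟩, hz⟩ := hcomp.exists_isMaxOn ⟨x₀, hx₀, by simp⟩
    (hcont.mono Set.inter_subset_left)
  have hx₀z : f x₀ ≤ f z := hz ⟨hx₀, by simp⟩
  have hmax : ∀ y ∈ D, f y ≤ f z := by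
    intro y hy
    rcases le_total ‖y‖ (max M ‖x₀‖) with h | h
    · exact hz ⟨hy, by simpa using h⟩
    · linarith [hM y hy ((le_max_left _ _).trans h)]
  rcases hint z hzD with h | ⟨hnhds, hreg, hlap⟩
  · linarith
  · have : IsLocalMax f z := by filter_upwards [hnhds] with y hy using hmax y hy
    exact absurd (this.laplacian_nonpos hreg) (not_le.mpr hlap)

lemma hasFDerivAt_norm_sq_rpow_mul_inner_pow (β : ℝ) (k : ℕ) (e : E3) {x : E3} (hx : x ≠ 0) :
    HasFDerivAt (fun y : E3 => (‖y‖ ^ 2) ^ β * ⟪e, y⟫_ℝ ^ k)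
      ((2 * β * (‖x‖ ^ 2) ^ (β - 1) * ⟪e, x⟫_ℝ ^ k) • innerSL ℝ x +
        (k * (‖x‖ ^ 2) ^ β * ⟪e, x⟫_ℝ ^ (k - 1)) • innerSL ℝ e) x := by
  have hq : ‖x‖ ^ 2 ≠ 0 := by positivity
  have h1 := ((hasStrictFDerivAt_norm_sq x).hasFDerivAt).rpow_const (p := β) (Or.inl hq)
  have h2 := ((innerSL ℝ e).hasFDerivAt (x := x)).pow k
  refine (h1.mul h2).congr_fderiv ?_
  ext v
  simp
  ring

lemma contDiffAt_norm_sq_rpow_mul_inner_pow (β : ℝ) (k : ℕ) (e : E3) {x : E3} (hx : x ≠ 0) :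
    ContDiffAt ℝ 2 (fun y : E3 => (‖y‖ ^ 2) ^ β * ⟪e, y⟫_ℝ ^ k) x := by
  have hq : ‖x‖ ^ 2 ≠ 0 := by positivity
  have h1 : ContDiffAt ℝ 2 (fun y : E3 => ‖y‖ ^ 2) x := (contDiff_norm_sq ℝ).contDiffAt
  have h2 : ContDiffAt ℝ 2 (fun y : E3 => ⟪e, y⟫_ℝ) x := (innerSL ℝ e).contDiff.contDiffAt
  exact (h1.rpow_const_of_ne hq).mul (h2.pow k)

lemma laplacian_norm_sq_rpow_mul_inner_pow (β : ℝ) (k : ℕ) {e : E3} (he : ‖e‖ = 1) {x : E3}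
    (hx : x ≠ 0) :
    Laplacian.laplacian (fun y : E3 => (‖y‖ ^ 2) ^ β * ⟪e, y⟫_ℝ ^ k) x =
      2 * β * (2 * β + 1 + 2 * k) * (‖x‖ ^ 2) ^ (β - 1) * ⟪e, x⟫_ℝ ^ k +
        k * (k - 1 : ℕ) * (‖x‖ ^ 2) ^ β * ⟪e, x⟫_ℝ ^ (k - 1 - 1) := by
  rw [← lap3_eq_laplacian (contDiffAt_norm_sq_rpow_mul_inner_pow β k e hx)]
  have hpd (i : Fin 3) : pd3 i (fun y => pd3 i (fun y : E3 => (‖y‖ ^ 2) ^ β * ⟪e, y⟫_ℝ ^ k) y) x =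
      2 * β * ((2 * (β - 1) * (‖x‖ ^ 2) ^ (β - 1 - 1) * ⟪e, x⟫_ℝ ^ k * x i +
        k * (‖x‖ ^ 2) ^ (β - 1) * ⟪e, x⟫_ℝ ^ (k - 1) * e i) * x i +
          (‖x‖ ^ 2) ^ (β - 1) * ⟪e, x⟫_ℝ ^ k) +
      k * e i * (2 * β * (‖x‖ ^ 2) ^ (β - 1) * ⟪e, x⟫_ℝ ^ (k - 1) * x i +
        (k - 1 : ℕ) * (‖x‖ ^ 2) ^ β * ⟪e, x⟫_ℝ ^ (k - 1 - 1) * e i) := by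
    have hev : (fun y => pd3 i (fun y : E3 => (‖y‖ ^ 2) ^ β * ⟪e, y⟫_ℝ ^ k) y) =ᶠ[𝓝 x]
        fun y => 2 * β * (((‖y‖ ^ 2) ^ (β - 1) * ⟪e, y⟫_ℝ ^ k) *
            ⟪EuclideanSpace.single i (1 : ℝ), y⟫_ℝ) +
          k * e i * ((‖y‖ ^ 2) ^ β * ⟪e, y⟫_ℝ ^ (k - 1)) := by
      filter_upwards [isOpen_ne.mem_nhds hx] with y hy
      rw [pd3, (hasFDerivAt_norm_sq_rpow_mul_inner_pow β k e hy).fderiv]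
      simp [EuclideanSpace.inner_single_left, EuclideanSpace.inner_single_right]
      ring
    have h1 := hasFDerivAt_norm_sq_rpow_mul_inner_pow (β - 1) k e hx
    have h2 := hasFDerivAt_norm_sq_rpow_mul_inner_pow β (k - 1) e hx
    have h3 := (innerSL ℝ (EuclideanSpace.single i (1 : ℝ) : E3)).hasFDerivAt (x := x)
    have h4 := ((h1.mul h3).const_mul (2 * β)).add (h2.const_mul (k * e i))
    rw [pd3, hev.fderiv_eq]
    refine (congrArg (fun L : E3 →L[ℝ] ℝ => L (EuclideanSpace.single i 1)) h4.fderiv).trans ?_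
    simp [EuclideanSpace.inner_single_left, EuclideanSpace.inner_single_right]
    ring
  have hq : ‖x‖ ^ 2 = x 0 ^ 2 + x 1 ^ 2 + x 2 ^ 2 := by
    simp [EuclideanSpace.norm_sq_eq, Fin.sum_univ_three]
  have he2 : e 0 ^ 2 + e 1 ^ 2 + e 2 ^ 2 = 1 := by
    have : ‖e‖ ^ 2 = 1 := by rw [he]; norm_num
    simpa [EuclideanSpace.norm_sq_eq, Fin.sum_univ_three] using this
  have hl : ⟪e, x⟫_ℝ = e 0 * x 0 + e 1 * x 1 + e 2 * x 2 := by
    simp [PiLp.inner_apply, Fin.sum_univ_three, mul_comm]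
  have hβ : (‖x‖ ^ 2) ^ (β - 1 - 1) * (x 0 ^ 2 + x 1 ^ 2 + x 2 ^ 2) = (‖x‖ ^ 2) ^ (β - 1) := by
    rw [← hq, ← Real.rpow_add_one (by positivity)]
    congr 1
    ring
  have hk : k * (⟪e, x⟫_ℝ ^ (k - 1) * (e 0 * x 0 + e 1 * x 1 + e 2 * x 2)) =
      k * ⟪e, x⟫_ℝ ^ k := by
    rw [← hl]
    rcases k.eq_zero_or_pos with rfl | h
    · simp
    · rw [← pow_succ, Nat.sub_add_cancel h]
  simp only [lap3, Fin.sum_univ_three, hpd]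
  linear_combination 4 * β * (β - 1) * ⟪e, x⟫_ℝ ^ k * hβ +
    4 * β * (‖x‖ ^ 2) ^ (β - 1) * hk +
    k * (k - 1 : ℕ) * (‖x‖ ^ 2) ^ β * ⟪e, x⟫_ℝ ^ (k - 1 - 1) * he2

/-- The function `r ^ (-1 - τ) * (t + a * (1 - 2 * t ^ 2))` with `r = ‖y‖` and `t = ⟪e, y⟫ / r`,
a positive strictly superharmonic function on the half-space `0 ≤ ⟪e, y⟫`. -/
noncomputable def halfSpaceBarrier (τ a : ℝ) (e : E3) : E3 → ℝ :=
  (fun y => (‖y‖ ^ 2) ^ (-(2 + τ) / 2) * ⟪e, y⟫_ℝ ^ 1) +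
    a • ((fun y => (‖y‖ ^ 2) ^ (-(1 + τ) / 2) * ⟪e, y⟫_ℝ ^ 0) -
      (2 : ℝ) • fun y => (‖y‖ ^ 2) ^ (-(3 + τ) / 2) * ⟪e, y⟫_ℝ ^ 2)

lemma norm_sq_rpow (x : E3) (β : ℝ) : (‖x‖ ^ 2) ^ β = ‖x‖ ^ (2 * β) := by
  rw [Real.rpow_mul (norm_nonneg x)]
  norm_num

lemma norm_rpow_sub_nat {x : E3} (hx : x ≠ 0) (β : ℝ) (n : ℕ) :
    ‖x‖ ^ (β - n) * ‖x‖ ^ n = ‖x‖ ^ β := by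
  rw [Real.rpow_sub_natCast (by positivity)]
  field_simp

lemma contDiffAt_smul_sub_smul {f g : E3 → ℝ} {x : E3} (hf : ContDiffAt ℝ 2 f x)
    (hg : ContDiffAt ℝ 2 g x) (a b : ℝ) : ContDiffAt ℝ 2 (a • (f - b • g)) x :=
  (hf.sub (hg.const_smul b)).const_smul a

lemma laplacian_add_smul_sub_smul {f g h : E3 → ℝ} {x : E3} (hf : ContDiffAt ℝ 2 f x)
    (hg : ContDiffAt ℝ 2 g x) (hh : ContDiffAt ℝ 2 h x) (a b : ℝ) :
    Laplacian.laplacian (f + a • (g - b • h)) x = Laplacian.laplacian f x +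
      a * (Laplacian.laplacian g x - b * Laplacian.laplacian h x) := by
  have hbh : ContDiffAt ℝ 2 (b • h) x := hh.const_smul b
  have hgh : ContDiffAt ℝ 2 (g - b • h) x := hg.sub hbh
  rw [hf.laplacian_add (contDiffAt_smul_sub_smul hg hh a b), laplacian_smul a hgh,
    hg.laplacian_sub hbh, laplacian_smul b hh, smul_eq_mul, smul_eq_mul]

lemma contDiffAt_halfSpaceBarrier (τ a : ℝ) (e : E3) {x : E3} (hx : x ≠ 0) :
    ContDiffAt ℝ 2 (halfSpaceBarrier τ a e) x := by
  have c (β : ℝ) (k : ℕ) := contDiffAt_norm_sq_rpow_mul_inner_pow β k e hx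
  exact (c _ _).add (contDiffAt_smul_sub_smul (c _ _) (c _ _) _ _)

lemma halfSpaceBarrier_apply (τ a : ℝ) (e : E3) {x : E3} (hx : x ≠ 0) :
    halfSpaceBarrier τ a e x = ‖x‖ ^ (-1 - τ) *
      (⟪e, x⟫_ℝ / ‖x‖ + a * (1 - 2 * (⟪e, x⟫_ℝ / ‖x‖) ^ 2)) := by
  have hr : ‖x‖ ≠ 0 := by positivity
  have h1 : ‖x‖ ^ (-2 - τ) * ‖x‖ = ‖x‖ ^ (-1 - τ) := by
    rw [← norm_rpow_sub_nat hx (-1 - τ) 1]; norm_num; left; congr 1; ring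
  have h3 : ‖x‖ ^ (-3 - τ) * ‖x‖ ^ 2 = ‖x‖ ^ (-1 - τ) := by
    rw [← norm_rpow_sub_nat hx (-1 - τ) 2]; norm_num; left; congr 1; ring
  simp only [halfSpaceBarrier, Pi.add_apply, Pi.smul_apply, Pi.sub_apply, smul_eq_mul,
    norm_sq_rpow]
  rw [show 2 * (-(2 + τ) / 2) = -2 - τ by ring, show 2 * (-(1 + τ) / 2) = -1 - τ by ring,
    show 2 * (-(3 + τ) / 2) = -3 - τ by ring]
  obtain ⟨t, ht⟩ : ∃ t, ⟪e, x⟫_ℝ = ‖x‖ * t := ⟨⟪e, x⟫_ℝ / ‖x‖, by field_simp⟩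
  rw [ht, mul_div_cancel_left₀ _ hr]
  linear_combination t * h1 - 2 * a * t ^ 2 * h3

lemma laplacian_halfSpaceBarrier (τ a : ℝ) {e : E3} (he : ‖e‖ = 1) {x : E3} (hx : x ≠ 0) :
    Laplacian.laplacian (halfSpaceBarrier τ a e) x = ‖x‖ ^ (-3 - τ) *
      (-(2 - τ - τ ^ 2) * (⟪e, x⟫_ℝ / ‖x‖) +
        a * (τ + τ ^ 2 + 2 * (6 - τ - τ ^ 2) * (⟪e, x⟫_ℝ / ‖x‖) ^ 2 - 4)) := by
  have hr : ‖x‖ ≠ 0 := by positivity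
  have h1 : ‖x‖ ^ (-4 - τ) * ‖x‖ = ‖x‖ ^ (-3 - τ) := by
    rw [← norm_rpow_sub_nat hx (-3 - τ) 1]; norm_num; left; congr 1; ring
  have h3 : ‖x‖ ^ (-5 - τ) * ‖x‖ ^ 2 = ‖x‖ ^ (-3 - τ) := by
    rw [← norm_rpow_sub_nat hx (-3 - τ) 2]; norm_num; left; congr 1; ring
  have c (β : ℝ) (k : ℕ) := contDiffAt_norm_sq_rpow_mul_inner_pow β k e hx
  rw [halfSpaceBarrier, laplacian_add_smul_sub_smul (c _ _) (c _ _) (c _ _),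
    laplacian_norm_sq_rpow_mul_inner_pow _ _ he hx, laplacian_norm_sq_rpow_mul_inner_pow _ _ he hx,
    laplacian_norm_sq_rpow_mul_inner_pow _ _ he hx]
  simp only [norm_sq_rpow]
  rw [show 2 * (-(2 + τ) / 2 - 1) = -4 - τ by ring, show 2 * (-(1 + τ) / 2 - 1) = -3 - τ by ring,
    show 2 * (-(3 + τ) / 2 - 1) = -5 - τ by ring, show 2 * (-(3 + τ) / 2) = -3 - τ by ring]
  obtain ⟨t, ht⟩ : ∃ t, ⟪e, x⟫_ℝ = ‖x‖ * t := ⟨⟪e, x⟫_ℝ / ‖x‖, by field_simp⟩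
  rw [ht, mul_div_cancel_left₀ _ hr]
  norm_num
  linear_combination (-(2 - τ - τ ^ 2) * t) * h1 + 2 * a * (6 - τ - τ ^ 2) * t ^ 2 * h3

lemma inner_div_norm_mem_Icc {e x : E3} (he : ‖e‖ = 1) (hx : x ≠ 0) (hex : 0 ≤ ⟪e, x⟫_ℝ) :
    ⟪e, x⟫_ℝ / ‖x‖ ∈ Set.Icc (0 : ℝ) 1 := by
  refine ⟨by positivity, (div_le_one (by positivity)).mpr ?_⟩
  simpa [he] using real_inner_le_norm e x

lemma le_halfSpaceBarrier {τ a : ℝ} {e x : E3} (he : ‖e‖ = 1) (hx : x ≠ 0)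
    (hex : 0 ≤ ⟪e, x⟫_ℝ) (ha : a ∈ Set.Icc (0 : ℝ) (1 / 2)) :
    a * ‖x‖ ^ (-1 - τ) ≤ halfSpaceBarrier τ a e x := by
  obtain ⟨h0, h1⟩ := inner_div_norm_mem_Icc he hx hex
  rw [halfSpaceBarrier_apply τ a e hx, mul_comm a]
  gcongr
  nlinarith [mul_nonneg h0 (sub_nonneg.mpr h1), mul_nonneg ha.1 (mul_nonneg h0 (sub_nonneg.mpr h1)),
    mul_nonneg h0 (sub_nonneg.mpr ha.2)]

lemma halfSpaceBarrier_le {τ a : ℝ} {e x : E3} (he : ‖e‖ = 1) (hx : x ≠ 0)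
    (hex : 0 ≤ ⟪e, x⟫_ℝ) (ha : a ∈ Set.Icc (0 : ℝ) (1 / 2)) :
    halfSpaceBarrier τ a e x ≤ 2 * ‖x‖ ^ (-1 - τ) := by
  obtain ⟨h0, h1⟩ := inner_div_norm_mem_Icc he hx hex
  rw [halfSpaceBarrier_apply τ a e hx, mul_comm 2 (‖x‖ ^ _)]
  gcongr
  nlinarith [mul_nonneg ha.1 (sq_nonneg (⟪e, x⟫_ℝ / ‖x‖)), ha.2]

lemma laplacian_halfSpaceBarrier_le {τ a : ℝ} {e x : E3} (he : ‖e‖ = 1) (hx : x ≠ 0)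
    (hex : 0 ≤ ⟪e, x⟫_ℝ) (hτ : 0 ≤ τ)
    (ha : 0 ≤ a) (haτ : 12 * a ≤ 2 - τ - τ ^ 2) :
    Laplacian.laplacian (halfSpaceBarrier τ a e) x ≤ -(2 * a) * ‖x‖ ^ (-3 - τ) := by
  obtain ⟨h0, h1⟩ := inner_div_norm_mem_Icc he hx hex
  rw [laplacian_halfSpaceBarrier τ a he hx, mul_comm (-(2 * a))]
  gcongr
  set t := ⟪e, x⟫_ℝ / ‖x‖
  have h2 : t ^ 2 ≤ t := by nlinarith
  have h3 : a * (2 * (6 - τ - τ ^ 2) * t ^ 2) ≤ a * (12 * t) := by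
    gcongr ?_ * ?_
    nlinarith [mul_nonneg (by positivity : 0 ≤ τ + τ ^ 2) (sq_nonneg t)]
  nlinarith [mul_nonneg h0 (sub_nonneg.mpr haτ), mul_nonneg ha (by linarith : 0 ≤ 2 - τ - τ ^ 2)]

lemma rpow_neg_one_sub_le_inv {r τ : ℝ} (hr : 1 ≤ r) (hτ : 0 ≤ τ) : r ^ (-1 - τ) ≤ r⁻¹ := by
  rw [← Real.rpow_neg_one]
  exact Real.rpow_le_rpow_of_exponent_le hr (by linarith)

lemma exists_norm_le_imp_le_of_le_div {f : E3 → ℝ} {D : Set E3} {N : ℝ} (hN : 0 ≤ N)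
    (hf : ∀ x ∈ D, f x ≤ N * ‖x‖⁻¹) (ε : ℝ) (hε : 0 < ε) :
    ∃ M : ℝ, ∀ x ∈ D, M ≤ ‖x‖ → f x ≤ ε := by
  refine ⟨N / ε + 1, fun x hx hM => (hf x hx).trans ?_⟩
  have h0 : 0 ≤ N / ε := by positivity
  have hpos : 0 < ‖x‖ := by linarith
  have : N / ε ≤ ‖x‖ := by linarith
  rw [div_le_iff₀ hε] at this
  rw [← div_eq_mul_inv, div_le_iff₀ hpos]
  linarith

/-- Two values at the same distance from the origin differ by `O(r ^ (-1 - τ))`. -/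
lemma exists_sub_le_of_norm_eq {τ : ℝ} (hτ : τ ∈ Set.Ioo (0 : ℝ) 1) {C : ℝ} (hC : 0 ≤ C)
    {u : E3 → ℝ} (hreg : ∀ x : E3, 1 < ‖x‖ → ContDiffAt ℝ 2 u x)
    (hu : ∀ x : E3, 1 < ‖x‖ → |u x| ≤ C * ‖x‖⁻¹)
    (hlap : ∀ x : E3, 1 < ‖x‖ → |Laplacian.laplacian u x| ≤ C * ‖x‖ ^ (-3 - τ)) :
    ∃ K : ℝ, 0 ≤ K ∧ ∀ x y : E3, ‖x‖ = ‖y‖ → 2 ≤ ‖x‖ → u x - u y ≤ K * ‖x‖ ^ (-1 - τ) := by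
  obtain ⟨hτ0, hτ1⟩ := hτ
  obtain ⟨a, ha0, haτ⟩ : ∃ a : ℝ, 0 < a ∧ 12 * a = 2 - τ - τ ^ 2 :=
    ⟨(2 - τ - τ ^ 2) / 12, by nlinarith, by ring⟩
  have ha : a ∈ Set.Icc (0 : ℝ) (1 / 2) := ⟨ha0.le, by nlinarith⟩
  set K := (4 * C + 1) / a with hK
  have hK0 : 0 < K := by positivity
  have hKa : K * a = 4 * C + 1 := by rw [hK]; field_simp
  refine ⟨K * 2, by positivity, fun x y hxy hx2 => ?_⟩
  have hx0 : x ≠ 0 := norm_pos_iff.mp (by linarith)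
  rcases eq_or_ne x y with rfl | hne
  · rw [sub_self]; positivity
  have hn : ‖x - y‖ ≠ 0 := norm_ne_zero_iff.mpr (sub_ne_zero.mpr hne)
  set e : E3 := ‖x - y‖⁻¹ • (x - y) with he_def
  have he : ‖e‖ = 1 := by rw [he_def, norm_smul, norm_inv, norm_norm, inv_mul_cancel₀ hn]
  let S : E3 ≃ₗᵢ[ℝ] E3 := Submodule.reflection (Submodule.span ℝ {x - y})ᗮ
  have hSx : S x = y := Submodule.reflection_sub hxy
  have hSfix (z : E3) (hz : ⟪e, z⟫_ℝ = 0) : S z = z := by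
    refine Submodule.reflection_mem_subspace_eq_self ?_
    rw [Submodule.mem_orthogonal_singleton_iff_inner_right]
    rw [he_def, real_inner_smul_left] at hz
    exact (mul_eq_zero.mp hz).resolve_left (inv_ne_zero hn)
  have hex : 0 ≤ ⟪e, x⟫_ℝ := by
    rw [he_def, real_inner_smul_left, inner_sub_left, real_inner_self_eq_norm_sq]
    have := real_inner_le_norm y x
    rw [← hxy] at this
    exact mul_nonneg (by positivity) (by linarith)
  let D : Set E3 := {z | 2 ≤ ‖z‖} ∩ {z | 0 ≤ ⟪e, z⟫_ℝ}
  have hD : IsClosed D := (isClosed_le continuous_const continuous_norm).inter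
    (isClosed_le continuous_const (continuous_const.inner continuous_id))
  let B := halfSpaceBarrier τ a e
  let f : E3 → ℝ := u + (-1 : ℝ) • (u ∘ S - (-K) • B)
  have hfz (z : E3) : f z = u z - u (S z) - K * B z := by
    simp only [f, Pi.add_apply, Pi.smul_apply, Pi.sub_apply, Function.comp_apply, smul_eq_mul]
    ring
  have hz0 {z : E3} (hz : z ∈ D) : z ≠ 0 := norm_pos_iff.mp (by linarith [hz.1.out])
  have hz1 {z : E3} (hz : z ∈ D) : 1 < ‖z‖ := by linarith [hz.1.out]
  have hB {z : E3} (hz : z ∈ D) : a * ‖z‖ ^ (-1 - τ) ≤ B z :=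
    le_halfSpaceBarrier he (hz0 hz) hz.2 ha
  have hS1 {z : E3} (hz : z ∈ D) : 1 < ‖S z‖ := by rw [S.norm_map]; exact hz1 hz
  have hregS {z : E3} (hz : z ∈ D) : ContDiffAt ℝ 2 (u ∘ S) z :=
    (hreg _ (hS1 hz)).comp z S.contDiff.contDiffAt
  have hregB {z : E3} (hz : z ∈ D) : ContDiffAt ℝ 2 B z :=
    contDiffAt_halfSpaceBarrier τ a e (hz0 hz)
  have hregf {z : E3} (hz : z ∈ D) : ContDiffAt ℝ 2 f z :=
    (hreg z (hz1 hz)).add (contDiffAt_smul_sub_smul (hregS hz) (hregB hz) _ _)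
  have hosc {z : E3} (hz : z ∈ D) : u z - u (S z) ≤ 2 * C * ‖z‖⁻¹ := by
    have h1 := hu z (hz1 hz)
    have h2 := hu (S z) (hS1 hz)
    rw [S.norm_map] at h2
    linarith [le_abs_self (u z), neg_abs_le (u (S z))]
  have key := nonpos_of_laplacian_pos hD (f := f)
    (fun z hz => (hregf hz).continuousAt.continuousWithinAt)
    (exists_norm_le_imp_le_of_le_div (N := 2 * C) (by positivity) fun z hz => by
      rw [hfz]
      have : 0 ≤ K * B z :=
        mul_nonneg hK0.le ((mul_nonneg ha0.le (Real.rpow_nonneg (norm_nonneg z) _)).trans (hB hz))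
      linarith [hosc hz])
    (fun z hz => by
      rcases (hz.1.out : 2 ≤ ‖z‖).eq_or_lt with h2 | h2
      · left
        rw [hfz]
        have h3 : K * (a * ‖z‖ ^ (-1 - τ)) ≤ K * B z := by gcongr; exact hB hz
        have h4 : (1 / 4 : ℝ) ≤ ‖z‖ ^ (-1 - τ) := by
          rw [← h2]
          calc (1 / 4 : ℝ) = 2 ^ (-2 : ℝ) := by
                rw [Real.rpow_neg (by norm_num)]; norm_num
            _ ≤ 2 ^ (-1 - τ) := Real.rpow_le_rpow_of_exponent_le (by norm_num) (by linarith)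
        have h5 := hosc hz
        rw [← h2] at h5
        rw [← mul_assoc, hKa] at h3
        nlinarith
      rcases (hz.2.out : 0 ≤ ⟪e, z⟫_ℝ).eq_or_lt with h3 | h3
      · left
        rw [hfz, hSfix z h3.symm, sub_self, zero_sub, neg_nonpos]
        exact mul_nonneg hK0.le
          ((mul_nonneg ha0.le (Real.rpow_nonneg (norm_nonneg z) _)).trans (hB hz))
      · right
        refine ⟨?_, hregf hz, ?_⟩
        · refine inter_mem ?_ ?_
          · filter_upwards [(isOpen_lt continuous_const continuous_norm).mem_nhds h2] with w hw
              using le_of_lt hw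
          · have ho : IsOpen {w : E3 | 0 < ⟪e, w⟫_ℝ} :=
              isOpen_lt continuous_const (continuous_const.inner continuous_id)
            filter_upwards [ho.mem_nhds h3] with w hw using le_of_lt hw
        · have h4 : Laplacian.laplacian f z = _ := laplacian_add_smul_sub_smul
            (hreg z (hz1 hz)) (hregS hz) (hregB hz) _ _
          have h5 := laplacian_halfSpaceBarrier_le he (hz0 hz) hz.2 hτ0.le ha0.le haτ.le
          have h6 := hlap z (hz1 hz)
          have h7 := hlap (S z) (hS1 hz)
          rw [S.norm_map] at h7
          rw [h4, laplacian_comp_linearIsometryEquiv]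
          have h8 : K * Laplacian.laplacian B z ≤ K * (-(2 * a) * ‖z‖ ^ (-3 - τ)) := by
            gcongr
          have h9 : K * (-(2 * a) * ‖z‖ ^ (-3 - τ)) = -(8 * C + 2) * ‖z‖ ^ (-3 - τ) := by
            linear_combination -2 * ‖z‖ ^ (-3 - τ) * hKa
          have h10 : 0 < ‖z‖ ^ (-3 - τ) :=
            Real.rpow_pos_of_pos (norm_pos_iff.mpr (hz0 hz)) _
          nlinarith [neg_abs_le (Laplacian.laplacian u z), le_abs_self (Laplacian.laplacian u (S z)),
            mul_nonneg hC h10.le])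
    x ⟨hx2, hex⟩
  rw [hfz, hSx] at key
  have : K * B x ≤ K * (2 * ‖x‖ ^ (-1 - τ)) := by
    gcongr
    exact halfSpaceBarrier_le he hx0 hex ha
  linarith

/-- Comparison with a radial supersolution outside a ball. -/
lemma le_div_norm_of_le_on_sphere {τ : ℝ} (hτ : 0 ≤ τ) {C A : ℝ} (hC : 0 ≤ C)
    (hA : 0 < A) (hCA : C < A * (τ * (1 + τ))) {u : E3 → ℝ}
    (hreg : ∀ x : E3, 1 < ‖x‖ → ContDiffAt ℝ 2 u x)
    (hu : ∀ x : E3, 1 < ‖x‖ → |u x| ≤ C * ‖x‖⁻¹)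
    (hlap : ∀ x : E3, 1 < ‖x‖ → |Laplacian.laplacian u x| ≤ C * ‖x‖ ^ (-3 - τ))
    {R b : ℝ} (hR : 2 ≤ R) (hb : ∀ x : E3, ‖x‖ = R → u x ≤ b * R⁻¹ - A * R ^ (-1 - τ))
    {x : E3} (hx : R ≤ ‖x‖) : u x ≤ b * ‖x‖⁻¹ := by
  let e : E3 := EuclideanSpace.single 0 1
  have he : ‖e‖ = 1 := by simp [e]
  let D : Set E3 := {z | R ≤ ‖z‖}
  let g (β : ℝ) : E3 → ℝ := fun y => (‖y‖ ^ 2) ^ β * ⟪e, y⟫_ℝ ^ 0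
  let f : E3 → ℝ := u + A • (g (-(1 + τ) / 2) - (b / A) • g (-1 / 2))
  have hfz (z : E3) : f z = u z + A * ‖z‖ ^ (-1 - τ) - b * ‖z‖⁻¹ := by
    simp only [f, g, Pi.add_apply, Pi.smul_apply, Pi.sub_apply, smul_eq_mul, norm_sq_rpow,
      pow_zero, mul_one]
    rw [show 2 * (-(1 + τ) / 2) = -1 - τ by ring, show (2 : ℝ) * (-1 / 2) = -1 by ring,
      Real.rpow_neg_one]
    field_simp
    ring
  have hz1 {z : E3} (hz : z ∈ D) : 1 < ‖z‖ := by linarith [hz.out]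
  have hz0 {z : E3} (hz : z ∈ D) : z ≠ 0 := norm_pos_iff.mp (by linarith [hz.out])
  have hg (β : ℝ) {z : E3} (hz : z ∈ D) : ContDiffAt ℝ 2 (g β) z :=
    contDiffAt_norm_sq_rpow_mul_inner_pow β 0 e (hz0 hz)
  have hregf {z : E3} (hz : z ∈ D) : ContDiffAt ℝ 2 f z :=
    (hreg z (hz1 hz)).add (contDiffAt_smul_sub_smul (hg _ hz) (hg _ hz) _ _)
  have key := nonpos_of_laplacian_pos (f := f)
    (isClosed_le continuous_const continuous_norm : IsClosed D)
    (fun z hz => (hregf hz).continuousAt.continuousWithinAt)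
    (exists_norm_le_imp_le_of_le_div (N := C + A + |b|) (by positivity) fun z hz => by
      rw [hfz]
      have h1 := (le_abs_self _).trans (hu z (hz1 hz))
      have h2 : A * ‖z‖ ^ (-1 - τ) ≤ A * ‖z‖⁻¹ := by
        gcongr
        exact rpow_neg_one_sub_le_inv (hz1 hz).le hτ
      have h3 : -b * ‖z‖⁻¹ ≤ |b| * ‖z‖⁻¹ := by
        gcongr
        exact neg_le_abs b
      linarith)
    (fun z hz => by
      rcases (hz.out : R ≤ ‖z‖).eq_or_lt with h2 | h2
      · left
        have := hb z h2.symm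
        rw [hfz, ← h2]
        linarith
      · right
        refine ⟨?_, hregf hz, ?_⟩
        · filter_upwards [(isOpen_lt continuous_const continuous_norm).mem_nhds h2] with w hw
            using le_of_lt hw
        · have h4 : Laplacian.laplacian f z = _ := laplacian_add_smul_sub_smul
            (hreg z (hz1 hz)) (hg _ hz) (hg _ hz) _ _
          have h10 : 0 < ‖z‖ ^ (-3 - τ) :=
            Real.rpow_pos_of_pos (norm_pos_iff.mpr (hz0 hz)) _
          rw [h4, laplacian_norm_sq_rpow_mul_inner_pow _ _ he (hz0 hz),
            laplacian_norm_sq_rpow_mul_inner_pow _ _ he (hz0 hz), norm_sq_rpow,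
            show 2 * (-(1 + τ) / 2 - 1) = -3 - τ by ring]
          have h6 := (neg_abs_le _).trans' (neg_le_neg (hlap z (hz1 hz)))
          norm_num
          nlinarith [mul_lt_mul_of_pos_right hCA h10])
    x hx
  rw [hfz] at key
  have : 0 ≤ A * ‖x‖ ^ (-1 - τ) := mul_nonneg hA.le (Real.rpow_nonneg (norm_nonneg x) _)
  linarith

/-- The function `‖x‖ * u x` oscillates by at most `O(R ^ (-τ))` outside the ball of radius `R`. -/
lemma exists_abs_norm_mul_sub_le {τ : ℝ} (hτ : τ ∈ Set.Ioo (0 : ℝ) 1) {C : ℝ} (hC : 0 ≤ C)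
    {u : E3 → ℝ} (hreg : ∀ x : E3, 1 < ‖x‖ → ContDiffAt ℝ 2 u x)
    (hu : ∀ x : E3, 1 < ‖x‖ → |u x| ≤ C * ‖x‖⁻¹)
    (hlap : ∀ x : E3, 1 < ‖x‖ → |Laplacian.laplacian u x| ≤ C * ‖x‖ ^ (-3 - τ)) :
    ∃ N : ℝ, 0 ≤ N ∧ ∀ x y : E3, 2 ≤ ‖x‖ → ‖x‖ ≤ ‖y‖ →
      |‖y‖ * u y - ‖x‖ * u x| ≤ N * ‖x‖ ^ (-τ) := by
  obtain ⟨K, hK0, hK⟩ := exists_sub_le_of_norm_eq hτ hC hreg hu hlap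
  have hs : 0 < τ * (1 + τ) := mul_pos hτ.1 (by linarith [hτ.1])
  set A := (C + 1) / (τ * (1 + τ)) with hA
  have hA0 : 0 < A := by positivity
  have hCA : C < A * (τ * (1 + τ)) := by
    rw [hA, div_mul_cancel₀ _ hs.ne']
    linarith
  refine ⟨K + A, by positivity, fun x y hx hxy => ?_⟩
  have hx0 : 0 < ‖x‖ := by linarith
  have hy0 : 0 < ‖y‖ := by linarith
  have hpow : ‖x‖ ^ (-τ) * ‖x‖⁻¹ = ‖x‖ ^ (-1 - τ) := by
    rw [← Real.rpow_neg_one, ← Real.rpow_add hx0]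
    congr 1
    ring
  have hupper := le_div_norm_of_le_on_sphere hτ.1.le hC hA0 hCA hreg hu hlap hx
    (b := ‖x‖ * u x + (K + A) * ‖x‖ ^ (-τ)) (fun z hz => by
      have h1 := hK z x hz (hz ▸ hx)
      rw [hz] at h1
      have h2 : (‖x‖ * u x + (K + A) * ‖x‖ ^ (-τ)) * ‖x‖⁻¹ =
          u x + (K + A) * ‖x‖ ^ (-1 - τ) := by
        rw [← hpow]
        field_simp
      rw [h2]
      linarith) hxy
  have hlower := le_div_norm_of_le_on_sphere hτ.1.le hC hA0 hCA (u := -u)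
    (fun z hz => (hreg z hz).neg) (fun z hz => by simpa using hu z hz)
    (fun z hz => by simpa [laplacian_neg] using hlap z hz) hx
    (b := -(‖x‖ * u x) + (K + A) * ‖x‖ ^ (-τ)) (fun z hz => by
      have h1 := hK x z hz.symm hx
      have h2 : (-(‖x‖ * u x) + (K + A) * ‖x‖ ^ (-τ)) * ‖x‖⁻¹ =
          -u x + (K + A) * ‖x‖ ^ (-1 - τ) := by
        rw [← hpow]
        field_simp
      rw [h2, Pi.neg_apply]
      linarith) hxy
  rw [← div_eq_mul_inv, le_div_iff₀ hy0] at hupper hlower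
  rw [Pi.neg_apply] at hlower
  rw [abs_le]
  constructor <;> linarith

/-- A function that is Cauchy at infinity with rate `‖x‖ ^ (-τ)` converges with that rate. -/
lemma exists_abs_sub_le_rpow {τ N : ℝ} (hτ : 0 < τ) {F : E3 → ℝ}
    (hF : ∀ x y : E3, 2 ≤ ‖x‖ → ‖x‖ ≤ ‖y‖ → |F y - F x| ≤ N * ‖x‖ ^ (-τ)) :
    ∃ c : ℝ, ∀ x : E3, 2 ≤ ‖x‖ → |F x - c| ≤ N * ‖x‖ ^ (-τ) := by
  let p : ℕ → E3 := fun n => ((n : ℝ) + 2) • EuclideanSpace.single 0 1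
  have hp (n : ℕ) : ‖p n‖ = n + 2 := by
    have : (0 : ℝ) ≤ n + 2 := by positivity
    simp [p, norm_smul, abs_of_nonneg this]
  have hpt : Tendsto (fun n => ‖p n‖) atTop atTop := by
    simp only [hp]
    exact tendsto_atTop_add_const_right _ _ tendsto_natCast_atTop_atTop
  have hcauchy : CauchySeq fun n => F (p n) := by
    refine cauchySeq_of_le_tendsto_0' (fun n => N * ‖p n‖ ^ (-τ)) (fun n m hnm => ?_) ?_
    · rw [dist_comm, Real.dist_eq]
      refine hF _ _ ?_ ?_ <;> rw [hp]
      · linarith [(Nat.cast_nonneg n : (0 : ℝ) ≤ n)]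
      · rw [hp]
        gcongr
    · simpa using ((tendsto_rpow_neg_atTop hτ).comp hpt).const_mul N
  obtain ⟨c, hc⟩ := cauchySeq_tendsto_of_complete hcauchy
  refine ⟨c, fun x hx => ?_⟩
  rw [abs_sub_comm]
  refine le_of_tendsto (hc.sub_const (F x)).abs ?_
  filter_upwards [hpt.eventually_ge_atTop ‖x‖] with n hn using hF x (p n) hx hn

/-- Let `τ ∈ (0,1)` and let `u` be `C²` on `{|x| > 1} ⊂ ℝ³` with `|u(x)| ≤ C|x|⁻¹` and
`|Δu(x)| ≤ C|x|^{-3-τ}`.  Then there is `c ∈ ℝ` with `u(x) = c/|x| + o(|x|^{-1-τ/2})` as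
`|x| → ∞`, i.e. `|x|^{1+τ/2} |u(x) − c/|x|| → 0`. -/
theorem harmonic_expansion_at_infinity (τ : ℝ) (hτ : τ ∈ Set.Ioo (0 : ℝ) 1) (C : ℝ)
    (u : EuclideanSpace ℝ (Fin 3) → ℝ)
    (hreg : ContDiffOn ℝ 2 u {x : EuclideanSpace ℝ (Fin 3) | 1 < ‖x‖})
    (hu : ∀ x : EuclideanSpace ℝ (Fin 3), 1 < ‖x‖ → |u x| ≤ C * ‖x‖⁻¹)
    (hlap : ∀ x : EuclideanSpace ℝ (Fin 3), 1 < ‖x‖ →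
      |lap3 u x| ≤ C * ‖x‖ ^ (-(3 : ℝ) - τ)) :
    ∃ c : ℝ, ∀ ε : ℝ, 0 < ε → ∃ M : ℝ, ∀ x : EuclideanSpace ℝ (Fin 3), M ≤ ‖x‖ →
      ‖x‖ ^ ((1 : ℝ) + τ / 2) * |u x - c / ‖x‖| ≤ ε := by
  have hopen : IsOpen {x : E3 | 1 < ‖x‖} := isOpen_lt continuous_const continuous_norm
  have hreg' (x : E3) (hx : 1 < ‖x‖) : ContDiffAt ℝ 2 u x := hreg.contDiffAt (hopen.mem_nhds hx)
  have hC : 0 ≤ C := by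
    have h := (abs_nonneg _).trans (hu (EuclideanSpace.single 0 2) (by simp))
    simpa using h
  obtain ⟨N, hN0, hN⟩ := exists_abs_norm_mul_sub_le hτ hC hreg' hu fun x hx => by
    rw [← lap3_eq_laplacian (hreg' x hx)]
    exact hlap x hx
  obtain ⟨c, hc⟩ := exists_abs_sub_le_rpow hτ.1 hN
  refine ⟨c, fun ε hε => ?_⟩
  have hlim : Tendsto (fun r : ℝ => N * r ^ (-(τ / 2))) atTop (𝓝 0) := by
    simpa using (tendsto_rpow_neg_atTop (half_pos hτ.1)).const_mul N
  obtain ⟨M, hM⟩ := eventually_atTop.mp (hlim.eventually_le_const hε)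
  refine ⟨max M 2, fun x hx => ?_⟩
  have hx2 : 2 ≤ ‖x‖ := (le_max_right _ _).trans hx
  have hx0 : 0 < ‖x‖ := by linarith
  refine le_trans ?_ (hM ‖x‖ ((le_max_left _ _).trans hx))
  have h1 : ‖x‖ * |u x - c / ‖x‖| = |‖x‖ * u x - c| := by
    rw [← abs_of_pos hx0, ← abs_mul, abs_of_pos hx0, mul_sub, mul_div_cancel₀ _ hx0.ne']
  calc ‖x‖ ^ ((1 : ℝ) + τ / 2) * |u x - c / ‖x‖|
      = ‖x‖ ^ (τ / 2) * |‖x‖ * u x - c| := by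
        rw [Real.rpow_add hx0, Real.rpow_one, ← h1]
        ring
    _ ≤ ‖x‖ ^ (τ / 2) * (N * ‖x‖ ^ (-τ)) := by
        gcongr
        exact hc x hx2
    _ = N * ‖x‖ ^ (-(τ / 2)) := by
        rw [mul_left_comm, ← Real.rpow_add hx0]
        congr 2
        ring
end

section
/- On the region {x ∈ ℝ³ : |x| > 1} equip ℝ³ with the Riemannian metric g_{ij}(x) = (1 + 1/|x|) δ_{ij}. Define y^k(x) = x^k − x^k/(4|x|) for k = 1,2,3. Then there is a constant C > 0 such that |Δ_g y^k(x)| ≤ C |x|^{-3} for all |x| > 1 and k = 1,2,3. -/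
open Real MeasureTheory

/-- The Laplace–Beltrami operator of a metric `g` (given as a matrix-valued function) in
coordinates: `Δ_g f = (det g)^{-1/2} ∂_i((det g)^{1/2} g^{ij} ∂_j f)`. -/
noncomputable def lapBel (g : EuclideanSpace ℝ (Fin 3) → Matrix (Fin 3) (Fin 3) ℝ)
    (f : EuclideanSpace ℝ (Fin 3) → ℝ) (x : EuclideanSpace ℝ (Fin 3)) : ℝ :=
  (Real.sqrt (g x).det)⁻¹ *
    ∑ i, pd3 i (fun z => Real.sqrt (g z).det * ∑ j, ((g z)⁻¹ i j) * pd3 j f z) x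

/-- The conformally flat metric `g_{ij}(x) = (1 + 1/|x|) δ_{ij}`. -/
noncomputable def gConf (x : EuclideanSpace ℝ (Fin 3)) : Matrix (Fin 3) (Fin 3) ℝ :=
  (1 + ‖x‖⁻¹) • (1 : Matrix (Fin 3) (Fin 3) ℝ)

theorem hasFDerivAt_norm_inv {E : Type*} [NormedAddCommGroup E] [InnerProductSpace ℝ E]
    {x : E} (hx : x ≠ 0) :
    HasFDerivAt (fun z : E => ‖z‖⁻¹) (-(‖x‖⁻¹ ^ 3) • innerSL ℝ x) x := by
  have hn : ‖x‖ ≠ 0 := norm_ne_zero_iff.mpr hx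
  have h1 : HasFDerivAt (fun z : E => ‖z‖ ^ 2) (2 • innerSL ℝ x) x :=
    (hasStrictFDerivAt_norm_sq x).hasFDerivAt
  have h2 := (hasDerivAt_inv (x := √(‖x‖ ^ 2)) (by simpa using hn)).comp_hasFDerivAt x
    (h1.sqrt (pow_ne_zero 2 hn))
  simp only [Function.comp_def, Real.sqrt_sq (norm_nonneg _)] at h2
  refine h2.congr_fderiv ?_
  ext v
  simp only [smul_apply, nsmul_eq_mul, smul_eq_mul, Nat.cast_ofNat]
  simp
  field_simp

theorem hasFDerivAt_coord (k : Fin 3) (x : EuclideanSpace ℝ (Fin 3)) :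
    HasFDerivAt (fun z : EuclideanSpace ℝ (Fin 3) => z k)
      (EuclideanSpace.proj k : EuclideanSpace ℝ (Fin 3) →L[ℝ] ℝ) x :=
  (EuclideanSpace.proj k : EuclideanSpace ℝ (Fin 3) →L[ℝ] ℝ).hasFDerivAt

theorem pd3_harmonicCoord (k j : Fin 3) {x : EuclideanSpace ℝ (Fin 3)} (hx : x ≠ 0) :
    pd3 j (fun z => z k - z k / (4 * ‖z‖)) x =
      (if j = k then 1 else 0) * (1 - ‖x‖⁻¹ / 4) + x k * x j * ‖x‖⁻¹ ^ 3 / 4 := by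
  have h := (hasFDerivAt_coord k x).sub
    (((hasFDerivAt_coord k x).mul (hasFDerivAt_norm_inv hx)).const_mul (1 / 4))
  have e : (fun z : EuclideanSpace ℝ (Fin 3) => z k - z k / (4 * ‖z‖)) =
      fun z => z k - 1 / 4 * (z k * ‖z‖⁻¹) := by
    funext z
    rw [div_eq_mul_inv, mul_inv]
    ring
  rw [pd3, e]
  erw [h.fderiv]
  simp [EuclideanSpace.inner_single_right, eq_comm (a := k)]
  split_ifs <;> ring

theorem one_add_norm_inv_pos (x : EuclideanSpace ℝ (Fin 3)) : 0 < 1 + ‖x‖⁻¹ := by positivity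

theorem sqrt_det_gConf (x : EuclideanSpace ℝ (Fin 3)) :
    √(gConf x).det = √(1 + ‖x‖⁻¹) ^ 3 := by
  have h := one_add_norm_inv_pos x
  rw [gConf, Matrix.det_smul, Matrix.det_one, mul_one, Fintype.card_fin,
    Real.sqrt_eq_iff_mul_self_eq (by positivity) (by positivity), ← mul_pow,
    Real.mul_self_sqrt h.le]

theorem gConf_inv (x : EuclideanSpace ℝ (Fin 3)) :
    (gConf x)⁻¹ = (1 + ‖x‖⁻¹)⁻¹ • (1 : Matrix (Fin 3) (Fin 3) ℝ) := by
  apply Matrix.inv_eq_right_inv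
  rw [gConf, smul_mul_smul_comm, mul_inv_cancel₀ (one_add_norm_inv_pos x).ne', one_smul, one_mul]

theorem flux_gConf (f : EuclideanSpace ℝ (Fin 3) → ℝ) (i : Fin 3)
    (x : EuclideanSpace ℝ (Fin 3)) :
    √(gConf x).det * ∑ j, (gConf x)⁻¹ i j * pd3 j f x = √(1 + ‖x‖⁻¹) * pd3 i f x := by
  have h := one_add_norm_inv_pos x
  have hq := Real.sq_sqrt h.le
  simp only [sqrt_det_gConf, gConf_inv, Matrix.smul_apply, Matrix.one_apply, smul_eq_mul,
    mul_ite, mul_one, mul_zero, ite_mul, zero_mul, Finset.sum_ite_eq, Finset.mem_univ, if_true]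
  linear_combination √(1 + ‖x‖⁻¹) * pd3 i f x * (1 + ‖x‖⁻¹)⁻¹ * hq +
    √(1 + ‖x‖⁻¹) * pd3 i f x * mul_inv_cancel₀ h.ne'

theorem pd3_flux_harmonicCoord (k i : Fin 3) {x : EuclideanSpace ℝ (Fin 3)} (hx : x ≠ 0) :
    pd3 i (fun z => √(gConf z).det *
        ∑ j, (gConf z)⁻¹ i j * pd3 j (fun z => z k - z k / (4 * ‖z‖)) z) x =
      √(1 + ‖x‖⁻¹) * ((if i = k then 1 else 0) * (‖x‖⁻¹ ^ 3 * x i / 2) +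
          x k * ‖x‖⁻¹ ^ 3 / 4 - 3 / 4 * x k * x i ^ 2 * ‖x‖⁻¹ ^ 5) -
        ‖x‖⁻¹ ^ 3 * x i / (2 * √(1 + ‖x‖⁻¹)) *
          ((if i = k then 1 else 0) * (1 - ‖x‖⁻¹ / 4) + x k * x i * ‖x‖⁻¹ ^ 3 / 4) := by
  have e : (fun z => √(gConf z).det *
        ∑ j, (gConf z)⁻¹ i j * pd3 j (fun z => z k - z k / (4 * ‖z‖)) z) =ᶠ[nhds x]
      fun z => √(1 + ‖z‖⁻¹) * ((if i = k then 1 else 0) * (1 - 1 / 4 * ‖z‖⁻¹) +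
        1 / 4 * (z k * z i * ‖z‖⁻¹ ^ 3)) := by
    filter_upwards [isOpen_ne.mem_nhds hx] with z hz
    rw [flux_gConf, pd3_harmonicCoord k i hz]
    ring
  have hs := hasFDerivAt_norm_inv hx
  have h := ((hs.const_add 1).sqrt (one_add_norm_inv_pos x).ne').mul
    ((((hs.const_mul (1 / 4)).const_sub 1).const_mul (if i = k then (1 : ℝ) else 0)).add
      ((((hasFDerivAt_coord k x).mul (hasFDerivAt_coord i x)).mul (hs.pow 3)).const_mul (1 / 4)))
  rw [pd3, e.fderiv_eq]
  generalize hc : (if i = k then (1 : ℝ) else 0) = c at h ⊢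
  erw [h.fderiv]
  have hki : (k = i) = (i = k) := propext eq_comm
  simp [EuclideanSpace.inner_single_right, hki, hc]
  by_cases hik : i = k
  · subst hik
    ring
  · ring

theorem lapBel_gConf_harmonicCoord (k : Fin 3) {x : EuclideanSpace ℝ (Fin 3)} (hx : x ≠ 0) :
    lapBel gConf (fun z => z k - z k / (4 * ‖z‖)) x =
      x k * ‖x‖⁻¹ ^ 4 / (2 * (1 + ‖x‖⁻¹) ^ 2) := by
  have hq := Real.sq_sqrt (one_add_norm_inv_pos x).le
  have hq0 : √(1 + ‖x‖⁻¹) ≠ 0 := (Real.sqrt_pos.mpr (one_add_norm_inv_pos x)).ne'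
  have hr : (x 0 ^ 2 + x 1 ^ 2 + x 2 ^ 2) * ‖x‖⁻¹ ^ 2 = 1 := by
    have h := EuclideanSpace.real_norm_sq_eq x
    rw [Fin.sum_univ_three] at h
    rw [← h, ← mul_pow, mul_inv_cancel₀ (norm_ne_zero_iff.mpr hx), one_pow]
  simp only [lapBel, pd3_flux_harmonicCoord k _ hx]
  rw [sqrt_det_gConf]
  generalize √(1 + ‖x‖⁻¹) = q at *
  generalize ‖x‖⁻¹ = s at *
  have key : ∑ i, (q * ((if i = k then 1 else 0) * (s ^ 3 * x i / 2) +
          x k * s ^ 3 / 4 - 3 / 4 * x k * x i ^ 2 * s ^ 5) -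
        s ^ 3 * x i / (2 * q) *
          ((if i = k then 1 else 0) * (1 - s / 4) + x k * x i * s ^ 3 / 4)) =
      x k * s ^ 4 / (2 * q) := by
    have hqi := mul_inv_cancel₀ hq0
    rw [Fin.sum_univ_three]
    fin_cases k <;> simp <;> [let y := x 0; let y := x 1; let y := x 2] <;> linear_combination
      (-(3 / 4 * q * y * s ^ 3) - y * s ^ 4 * q⁻¹ / 8) * hr + y * s ^ 3 / 2 * q⁻¹ * hq -
        y * s ^ 3 / 2 * q * hqi
  rw [key, ← hq]
  field_simp

/-- For the metric `g_{ij} = (1 + 1/|x|) δ_{ij}` on `{|x| > 1}` and the functions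
`y^k(x) = x^k − x^k/(4|x|)`, there is `C > 0` with `|Δ_g y^k(x)| ≤ C |x|⁻³` for all `|x| > 1`. -/
theorem asymptotically_harmonic_coordinates_example :
    ∃ C : ℝ, 0 < C ∧ ∀ x : EuclideanSpace ℝ (Fin 3), 1 < ‖x‖ → ∀ k : Fin 3,
      |lapBel gConf (fun z => z k - z k / (4 * ‖z‖)) x| ≤ C * ‖x‖ ^ (-(3 : ℝ)) := by
  refine ⟨1, one_pos, fun x hx k => ?_⟩
  have hn : 0 < ‖x‖ := by linarith
  have hk : |x k| ≤ ‖x‖ := by simpa using PiLp.norm_apply_le x k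
  have hd : 1 ≤ 2 * (1 + ‖x‖⁻¹) ^ 2 := by
    have : 0 < ‖x‖⁻¹ := by positivity
    nlinarith
  rw [lapBel_gConf_harmonicCoord k (norm_pos_iff.mp hn), Real.rpow_neg hn.le, one_mul,
    abs_div, abs_mul, abs_of_nonneg (by positivity : 0 ≤ ‖x‖⁻¹ ^ 4),
    abs_of_nonneg (by positivity : 0 ≤ 2 * (1 + ‖x‖⁻¹) ^ 2)]
  calc |x k| * ‖x‖⁻¹ ^ 4 / (2 * (1 + ‖x‖⁻¹) ^ 2) ≤ |x k| * ‖x‖⁻¹ ^ 4 :=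
        div_le_self (by positivity) hd
    _ ≤ ‖x‖ * ‖x‖⁻¹ ^ 4 := by gcongr
    _ = (‖x‖ ^ (3 : ℝ))⁻¹ := by
        rw [show (3 : ℝ) = ((3 : ℕ) : ℝ) by norm_num, Real.rpow_natCast]
        field_simp
end
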